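/- arXiv:1406.2296 — 12 statements merged into one kernel-verified Lean document; each statement's English description precedes it below -/
import Mathlib

section
/- Let 2 ≤ p < ∞, let r_1, r_2, …, r_m be independent Rademacher random variables (each equal to +1 or −1 with probability 1/2), and let u_1, u_2, …, u_m ∈ ℝ^d be deterministic vectors. Then E‖∑_{i=1}^m r_i u_i‖_p ≤ √p · (∑_{i=1}^m ‖u_i‖_p²)^{1/2}. -/
open Finset

/-- The `p`-norm of a vector in `ℝ^d`: `(∑ j, |x j| ^ p) ^ (1/p)`. -/
noncomputable def pnorm (p : ℝ) {d : ℕ} (x : Fin d → ℝ) : ℝ :=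
  (∑ j, |x j| ^ p) ^ (1 / p)

/-- The ±1 sign associated with a boolean (used to model Rademacher variables). -/
def radSign (b : Bool) : ℝ := if b then 1 else -1

lemma exp_moment (m : ℕ) (a : Fin m → ℝ) (t : ℝ) :
    ∑ r : Fin m → Bool, Real.exp (t * ∑ i, radSign (r i) * a i)
      ≤ 2 ^ m * Real.exp (t ^ 2 * (∑ i, a i ^ 2) / 2) := by
  have h1 : ∑ r : Fin m → Bool, Real.exp (t * ∑ i, radSign (r i) * a i)
      = ∏ i, ∑ b : Bool, Real.exp (t * (radSign b * a i)) := by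
    rw [Finset.prod_univ_sum]
    simp only [Fintype.piFinset_univ]
    refine Finset.sum_congr rfl fun r _ => ?_
    rw [← Real.exp_sum, Finset.mul_sum]
  rw [h1]
  have h2 : (2 : ℝ) ^ m * Real.exp (t ^ 2 * (∑ i, a i ^ 2) / 2)
      = ∏ i, (2 * Real.exp ((t * a i) ^ 2 / 2)) := by
    rw [Finset.prod_mul_distrib, ← Real.exp_sum]
    simp only [Finset.prod_const, Finset.card_univ, Fintype.card_fin]
    congr 2
    rw [Finset.mul_sum, Finset.sum_div]
    exact Finset.sum_congr rfl fun i _ => by ring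
  rw [h2]
  refine Finset.prod_le_prod (fun i _ => Finset.sum_nonneg fun b _ => (Real.exp_pos _).le)
    fun i _ => ?_
  have := Real.cosh_le_exp_half_sq (t * a i)
  rw [Real.cosh_eq] at this
  simp only [Fintype.sum_bool, radSign]
  simp
  linarith

lemma pow_le_exp (p y : ℝ) (hp : 2 ≤ p) (hy : 0 ≤ y) :
    y ^ p ≤ p ^ p * Real.exp (-p) * Real.exp y := by
  have hp0 : 0 < p := by linarith
  have h := Real.add_one_le_exp (y / p - 1)
  have h0 : 0 ≤ y / p := by positivity
  have h1 : y / p ≤ Real.exp (y / p - 1) := by linarith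
  have h2 := Real.rpow_le_rpow h0 h1 hp0.le
  rw [Real.div_rpow hy hp0.le, ← Real.exp_mul, div_le_iff₀ (by positivity)] at h2
  refine h2.trans (le_of_eq ?_)
  rw [mul_assoc, ← Real.exp_add, mul_comm]
  congr 2
  field_simp
  ring

lemma scalar_kh (m : ℕ) (p : ℝ) (hp : 2 ≤ p) (a : Fin m → ℝ) :
    ∑ r : Fin m → Bool, |∑ i, radSign (r i) * a i| ^ p
      ≤ 2 ^ m * (p * ∑ i, a i ^ 2) ^ (p / 2) := by
  have hp0 : 0 < p := by linarith
  have hS0 : 0 ≤ ∑ i, a i ^ 2 := Finset.sum_nonneg fun i _ => sq_nonneg _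
  rcases hS0.eq_or_lt with hS | hS
  · have ha : ∀ i, a i = 0 := by
      intro i
      have := (Finset.sum_eq_zero_iff_of_nonneg (fun i _ => sq_nonneg (a i))).1 hS.symm i
        (Finset.mem_univ i)
      exact pow_eq_zero_iff (two_ne_zero) |>.1 this
    simp only [ha, mul_zero, Finset.sum_const_zero, abs_zero, Real.zero_rpow hp0.ne']
    positivity
  set S := ∑ i, a i ^ 2 with hSdef
  set t := Real.sqrt (p / S) with ht
  have htpos : 0 < t := Real.sqrt_pos.2 (by positivity)
  have ht2 : t ^ 2 = p / S := Real.sq_sqrt (by positivity)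
  have hpt : ∀ x : ℝ, t ^ p * |x| ^ p
      ≤ p ^ p * Real.exp (-p) * (Real.exp (t * x) + Real.exp (-t * x)) := by
    intro x
    rw [← Real.mul_rpow htpos.le (abs_nonneg x)]
    refine (pow_le_exp p _ hp (by positivity)).trans ?_
    refine mul_le_mul_of_nonneg_left ?_ (by positivity)
    have e1 := Real.exp_pos (t * x)
    have e2 := Real.exp_pos (-t * x)
    rcases abs_cases x with ⟨h, _⟩ | ⟨h, _⟩
    · rw [h]; linarith
    · rw [h, mul_neg, ← neg_mul]; linarith
  have hsum : t ^ p * ∑ r : Fin m → Bool, |∑ i, radSign (r i) * a i| ^ p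
      ≤ p ^ p * Real.exp (-p) * (2 * (2 ^ m * Real.exp (p / 2))) := by
    rw [Finset.mul_sum]
    refine (Finset.sum_le_sum fun r _ => hpt _).trans ?_
    rw [← Finset.mul_sum, Finset.sum_add_distrib]
    refine mul_le_mul_of_nonneg_left ?_ (by positivity)
    have e1 := exp_moment m a t
    have e2 := exp_moment m a (-t)
    have e3 : t ^ 2 * S / 2 = p / 2 := by rw [ht2]; field_simp
    rw [neg_sq, ← hSdef, e3] at e2
    rw [← hSdef, e3] at e1
    linarith
  have hc : Real.exp (-p) * (2 * Real.exp (p / 2)) ≤ 1 := by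
    have e4 : Real.exp (-p) * (2 * Real.exp (p / 2)) = 2 * Real.exp (-(p / 2)) := by
      rw [mul_left_comm, ← Real.exp_add]; congr 2; ring
    rw [e4, Real.exp_neg]
    have := Real.add_one_le_exp (p / 2)
    rw [← div_eq_mul_inv, div_le_one (Real.exp_pos _)]
    linarith
  have hsum2 : t ^ p * ∑ r : Fin m → Bool, |∑ i, radSign (r i) * a i| ^ p
      ≤ t ^ p * (2 ^ m * (p * S) ^ (p / 2)) := by
    have e5 : t ^ p * (p * S) ^ (p / 2) = p ^ p := by
      rw [ht, Real.sqrt_eq_rpow, ← Real.rpow_mul (by positivity),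
        show 1 / 2 * p = p / 2 by ring, ← Real.mul_rpow (by positivity) (by positivity),
        show p / S * (p * S) = p ^ (2 : ℝ) by rw [Real.rpow_two]; field_simp,
        ← Real.rpow_mul hp0.le]
      congr 1; ring
    calc _ ≤ _ := hsum
      _ = p ^ p * 2 ^ m * (Real.exp (-p) * (2 * Real.exp (p / 2))) := by ring
      _ ≤ p ^ p * 2 ^ m * 1 := mul_le_mul_of_nonneg_left hc (by positivity)
      _ = _ := by rw [← e5]; ring
  exact le_of_mul_le_mul_left hsum2 (by positivity)

lemma pnorm_nonneg (p : ℝ) {d : ℕ} (x : Fin d → ℝ) : 0 ≤ pnorm p x := by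
  unfold pnorm; positivity

lemma pnorm_sum_le (q : ℝ) (hq : 1 ≤ q) {d m : ℕ} (v : Fin m → Fin d → ℝ) :
    pnorm q (∑ i, v i) ≤ ∑ i, pnorm q (v i) := by
  refine Finset.le_sum_of_subadditive (pnorm q) ?_ ?_ _ _
  · have : q ≠ 0 := by linarith
    simp [pnorm, Real.zero_rpow this, Real.zero_rpow (inv_ne_zero this)]
  · intro x y
    exact Real.Lp_add_le Finset.univ x y hq

theorem khintchine_vector (d m : ℕ) (p : ℝ) (hp : 2 ≤ p)
    (u : Fin m → Fin d → ℝ) :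
    (1 / 2 ^ m : ℝ) *
        ∑ r : Fin m → Bool, pnorm p (∑ i, radSign (r i) • u i)
      ≤ Real.sqrt p * (∑ i, (pnorm p (u i)) ^ 2) ^ ((1 : ℝ) / 2) := by
  have hp0 : 0 < p := by linarith
  have hJ := Real.arith_mean_le_rpow_mean (Finset.univ : Finset (Fin m → Bool))
    (fun _ => (1 / 2 ^ m : ℝ)) (fun r => pnorm p (∑ i, radSign (r i) • u i))
    (fun _ _ => by positivity) (by simp) (fun _ _ => pnorm_nonneg _ _)
    (show 1 ≤ p by linarith)
  rw [← Finset.mul_sum, ← Finset.mul_sum] at hJ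
  refine hJ.trans ?_
  have hpp : ∀ x : Fin d → ℝ, pnorm p x ^ p = ∑ j, |x j| ^ p := by
    intro x
    unfold pnorm
    rw [← Real.rpow_mul (by positivity), one_div_mul_cancel hp0.ne', Real.rpow_one]
  simp only [hpp]
  rw [Finset.sum_comm]
  have hS0 : ∀ j, 0 ≤ ∑ i, u i j ^ 2 := fun j => Finset.sum_nonneg fun i _ => sq_nonneg _
  have hB : (1 / 2 ^ m : ℝ) * ∑ j, ∑ r : Fin m → Bool, |(∑ i, radSign (r i) • u i) j| ^ p
      ≤ p ^ (p / 2) * ∑ j, (∑ i, u i j ^ 2) ^ (p / 2) := by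
    rw [one_div, inv_mul_le_iff₀ (by positivity), Finset.mul_sum, Finset.mul_sum]
    refine Finset.sum_le_sum fun j _ => ?_
    have := scalar_kh m p hp (fun i => u i j)
    rw [Real.mul_rpow hp0.le (hS0 j)] at this
    simpa [Finset.sum_apply] using this
  have hM := pnorm_sum_le (p / 2) (by linarith) (fun i j => u i j ^ 2)
  have hsq : ∀ i, pnorm (p / 2) (fun j => u i j ^ 2) = pnorm p (u i) ^ 2 := by
    intro i
    unfold pnorm
    rw [← Real.rpow_two, ← Real.rpow_mul (by positivity)]
    congr 1
    · refine Finset.sum_congr rfl fun j _ => ?_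
      rw [abs_pow, ← Real.rpow_two, ← Real.rpow_mul (abs_nonneg _)]
      congr 1; ring
    · field_simp
  simp only [hsq] at hM
  have hT0 : 0 ≤ ∑ j, (∑ i, u i j ^ 2) ^ (p / 2) :=
    Finset.sum_nonneg fun j _ => Real.rpow_nonneg (hS0 j) _
  have hL : pnorm (p / 2) (∑ i, fun j => u i j ^ 2)
      = (∑ j, (∑ i, u i j ^ 2) ^ (p / 2)) ^ (1 / (p / 2)) := by
    unfold pnorm
    congr 1
    refine Finset.sum_congr rfl fun j _ => ?_
    rw [Finset.sum_apply, abs_of_nonneg (hS0 j)]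
  rw [hL] at hM
  refine (Real.rpow_le_rpow (by positivity) hB (by positivity)).trans ?_
  rw [Real.mul_rpow (by positivity) hT0, ← Real.rpow_mul hp0.le,
    show p / 2 * (1 / p) = 1 / 2 by field_simp, ← Real.sqrt_eq_rpow]
  refine mul_le_mul_of_nonneg_left ?_ (Real.sqrt_nonneg _)
  have := Real.rpow_le_rpow (Real.rpow_nonneg hT0 _) hM (show (0 : ℝ) ≤ 1 / 2 by norm_num)
  rw [← Real.rpow_mul hT0, show 1 / (p / 2) * (1 / 2) = 1 / p by field_simp] at this
  exact this
end

section
/- Let X = {x_1, x_2, …, x_n} ⊂ ℝ^d be a finite set of vectors, let 2 ≤ p < ∞, let γ = max_{x ∈ X} ‖x‖_p, and let ε > 0. Then for every μ ∈ conv(X) and every integer m ≥ 4pγ²/ε², there exists an m-uniform vector μ' ∈ conv(X) such that ‖μ − μ'‖_p ≤ ε. -/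
open Finset

lemma aux_hasDerivAt (p : ℝ) (hp : 2 ≤ p) (x : ℝ) :
    HasDerivAt (fun x : ℝ => |x| ^ (p - 2) * x) ((p - 1) * |x| ^ (p - 2)) x := by
  rcases eq_or_lt_of_le hp with h | h
  · subst h
    simp only [sub_self, Real.rpow_zero, one_mul, mul_one]
    exact (hasDerivAt_id x).congr_deriv (by norm_num)
  · by_cases hx : x = 0
    · subst hx
      rw [hasDerivAt_iff_tendsto_slope_zero]
      have h0 : (p - 1) * |(0:ℝ)| ^ (p - 2) = |(0:ℝ)| ^ (p - 2) := by
        rw [abs_zero, Real.zero_rpow (by linarith)]; simp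
      rw [h0]
      have hc : Continuous (fun t : ℝ => |t| ^ (p - 2)) :=
        continuous_abs.rpow_const (fun _ => Or.inr (by linarith))
      refine ((hc.tendsto 0).mono_left nhdsWithin_le_nhds).congr' ?_
      filter_upwards [self_mem_nhdsWithin] with t ht
      have ht' : t ≠ 0 := ht
      simp only [zero_add, smul_eq_mul, mul_zero, sub_zero]
      field_simp
    · have h1 := ((hasDerivAt_abs hx).rpow_const (p := p - 2)
        (Or.inl (abs_ne_zero.mpr hx))).mul (hasDerivAt_id x)
      refine h1.congr_deriv ?_
      have ha : 0 < |x| := abs_pos.mpr hx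
      have e : |x| ^ (p - 2) = |x| ^ (p - 2 - 1) * |x| := by
        rw [← Real.rpow_add_one ha.ne']; congr 1; ring
      have hs : (SignType.sign x : ℝ) * x = |x| := sign_mul_self x
      simp only [id, mul_one]
      rw [e]
      linear_combination ((p-2) * |x| ^ (p - 2 - 1)) * hs

lemma aux_holder (p : ℝ) (hp : 2 ≤ p) {d : ℕ} (u y : Fin d → ℝ) :
    ∑ j, |u j| ^ (p - 2) * y j ^ 2 ≤
      (∑ j, |u j| ^ p) ^ (1 - 2 / p) * (∑ j, |y j| ^ p) ^ (2 / p) := by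
  rcases eq_or_lt_of_le hp with h | h
  · subst h
    simp
  · have hp0 : 0 < p := by linarith
    have hp2 : 0 < p - 2 := by linarith
    have hc : (p / (p - 2)).HolderConjugate (p / 2) := by
      rw [Real.holderConjugate_iff]
      constructor
      · rw [lt_div_iff₀ hp2]; linarith
      · field_simp; ring
    have := Real.inner_le_Lp_mul_Lq_of_nonneg Finset.univ hc
      (f := fun j => |u j| ^ (p - 2)) (g := fun j => y j ^ 2)
      (fun _ _ => by positivity) (fun _ _ => by positivity)
    refine this.trans (le_of_eq ?_)
    congr 1
    · congr 1
      · refine Finset.sum_congr rfl fun j _ => ?_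
        rw [← Real.rpow_mul (abs_nonneg _)]
        congr 1; field_simp
      · field_simp
    · congr 1
      · refine Finset.sum_congr rfl fun j _ => ?_
        rw [← sq_abs, ← Real.rpow_natCast, ← Real.rpow_mul (abs_nonneg _)]
        congr 1; push_cast; field_simp
      · field_simp

lemma aux_smooth (p δ : ℝ) (hp : 2 ≤ p) (hδ : 0 < δ) {d : ℕ} (z y : Fin d → ℝ)
    (hzy : ∑ j, |z j| ^ (p - 2) * z j * y j ≤ 0) :
    (δ + ∑ j, |z j + y j| ^ p) ^ (2 / p) ≤
      (δ + ∑ j, |z j| ^ p) ^ (2 / p) + (p - 1) * (∑ j, |y j| ^ p) ^ (2 / p) := by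
  have hp0 : 0 < p := by linarith
  set Y := (∑ j, |y j| ^ p) ^ (2 / p) with hY
  set h : ℝ → ℝ := fun t => δ + ∑ j, |z j + t * y j| ^ p with hh
  set h1 : ℝ → ℝ := fun t => ∑ j, |z j + t * y j| ^ (p - 2) * (z j + t * y j) * y j with hh1
  set h2 : ℝ → ℝ := fun t => ∑ j, |z j + t * y j| ^ (p - 2) * y j ^ 2 with hh2
  have hpos : ∀ t, 0 < h t := fun t => by
    have : 0 ≤ ∑ j, |z j + t * y j| ^ p := Finset.sum_nonneg fun _ _ => by positivity
    simp only [hh]; linarith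
  have hlin : ∀ j t, HasDerivAt (fun t : ℝ => z j + t * y j) (y j) t := fun j t => by
    simpa using ((hasDerivAt_id t).mul_const (y j)).const_add (z j)
  have dh : ∀ t, HasDerivAt h (p * h1 t) t := fun t => by
    have := (HasDerivAt.fun_sum (u := Finset.univ) fun j _ =>
      (hasDerivAt_abs_rpow (z j + t * y j) (p := p) (by linarith)).comp t (hlin j t)).const_add δ
    refine this.congr_deriv ?_
    simp only [hh1, Finset.mul_sum]
    exact Finset.sum_congr rfl fun j _ => by ring
  have dh1 : ∀ t, HasDerivAt h1 ((p - 1) * h2 t) t := fun t => by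
    have := (HasDerivAt.fun_sum (u := Finset.univ) fun j _ =>
      ((aux_hasDerivAt p hp (z j + t * y j)).comp t (hlin j t)).mul_const (y j))
    refine this.congr_deriv ?_
    simp only [hh2, Finset.mul_sum]
    exact Finset.sum_congr rfl fun j _ => by ring
  have dG : ∀ t, HasDerivAt (fun t => h t ^ (2 / p) - (p - 1) * Y * t ^ 2)
      (2 * (h t ^ (2 / p - 1) * h1 t) - 2 * (p - 1) * Y * t) t := fun t => by
    have := ((dh t).rpow_const (p := 2 / p) (Or.inl (hpos t).ne')).sub
      ((hasDerivAt_pow 2 t).const_mul ((p - 1) * Y))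
    refine this.congr_deriv ?_
    simp only [Nat.cast_ofNat]
    field_simp
    ring
  have dG1 : ∀ t, HasDerivAt (fun t => 2 * (h t ^ (2 / p - 1) * h1 t) - 2 * (p - 1) * Y * t)
      (2 * (p * h1 t * (2 / p - 1) * h t ^ (2 / p - 1 - 1) * h1 t
        + h t ^ (2 / p - 1) * ((p - 1) * h2 t)) - 2 * (p - 1) * Y) t := fun t => by
    have := ((((dh t).rpow_const (p := 2 / p - 1) (Or.inl (hpos t).ne')).mul (dh1 t)).const_mul
      2).sub ((hasDerivAt_id t).const_mul (2 * (p - 1) * Y))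
    refine this.congr_deriv ?_
    ring
  have hq : 2 / p ≤ 1 := by rw [div_le_one hp0]; exact hp
  have neg2 : ∀ t, 2 * (p * h1 t * (2 / p - 1) * h t ^ (2 / p - 1 - 1) * h1 t
        + h t ^ (2 / p - 1) * ((p - 1) * h2 t)) - 2 * (p - 1) * Y ≤ 0 := fun t => by
    have a1 : p * h1 t * (2 / p - 1) * h t ^ (2 / p - 1 - 1) * h1 t ≤ 0 := by
      have : 0 ≤ p * (1 - 2 / p) * h t ^ (2 / p - 1 - 1) * (h1 t) ^ 2 := by
        have := (hpos t).le
        have : 0 ≤ 1 - 2 / p := by linarith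
        positivity
      nlinarith
    have a2 : h t ^ (2 / p - 1) * h2 t ≤ Y := by
      have hY0 : 0 ≤ Y := Real.rpow_nonneg (Finset.sum_nonneg fun _ _ => by positivity) _
      have b1 : h2 t ≤ h t ^ (1 - 2 / p) * Y := by
        refine (aux_holder p hp (fun j => z j + t * y j) y).trans ?_
        refine mul_le_mul_of_nonneg_right ?_ hY0
        refine Real.rpow_le_rpow (Finset.sum_nonneg fun _ _ => by positivity) ?_ (by linarith)
        simp only [hh]; linarith
      calc h t ^ (2 / p - 1) * h2 t ≤ h t ^ (2 / p - 1) * (h t ^ (1 - 2 / p) * Y) :=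
            mul_le_mul_of_nonneg_left b1 (Real.rpow_nonneg (hpos t).le _)
        _ = Y := by
            rw [← mul_assoc, ← Real.rpow_add (hpos t)]
            simp
    nlinarith
  have anti1 : Antitone (fun t => 2 * (h t ^ (2 / p - 1) * h1 t) - 2 * (p - 1) * Y * t) :=
    antitone_of_hasDerivAt_nonpos dG1 neg2
  have h10 : h1 0 ≤ 0 := by simpa [hh1] using hzy
  have anti : AntitoneOn (fun t => h t ^ (2 / p) - (p - 1) * Y * t ^ 2) (Set.Ici 0) := by
    refine antitoneOn_of_deriv_nonpos (convex_Ici 0)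
      (fun t _ => (dG t).continuousAt.continuousWithinAt)
      (fun t _ => (dG t).differentiableAt.differentiableWithinAt) ?_
    intro t ht
    rw [interior_Ici] at ht
    rw [(dG t).deriv]
    refine (anti1 (le_of_lt ht)).trans ?_
    have : 0 ≤ h 0 ^ (2 / p - 1) := Real.rpow_nonneg (hpos 0).le _
    have := mul_nonpos_of_nonneg_of_nonpos this h10
    simp only [mul_zero, sub_zero]
    linarith
  have fin := anti (Set.mem_Ici.mpr le_rfl) (Set.mem_Ici.mpr zero_le_one) zero_le_one
  simp only [hh, one_mul, zero_mul, add_zero] at fin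
  linarith

lemma aux_add (p : ℝ) (hp : 2 ≤ p) {d : ℕ} (u v : Fin d → ℝ) :
    pnorm p (u + v) ≤ pnorm p u + pnorm p v :=
  Real.Lp_add_le Finset.univ u v (by linarith)

lemma aux_smul (p : ℝ) (hp : 2 ≤ p) {d : ℕ} (c : ℝ) (v : Fin d → ℝ) :
    pnorm p (c • v) = |c| * pnorm p v := by
  unfold pnorm
  simp only [Pi.smul_apply, smul_eq_mul, abs_mul]
  simp only [Real.mul_rpow (abs_nonneg _) (abs_nonneg _)]
  rw [← Finset.mul_sum, Real.mul_rpow (by positivity)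
    (Finset.sum_nonneg fun _ _ => by positivity), ← Real.rpow_mul (abs_nonneg _),
    mul_one_div_cancel (by linarith), Real.rpow_one]

lemma aux_nonneg (p : ℝ) {d : ℕ} (v : Fin d → ℝ) : 0 ≤ pnorm p v :=
  Real.rpow_nonneg (Finset.sum_nonneg fun _ _ => by positivity) _

lemma aux_sq (p : ℝ) {d : ℕ} (v : Fin d → ℝ) :
    (∑ j, |v j| ^ p) ^ (2 / p) = pnorm p v ^ 2 := by
  unfold pnorm
  rw [← Real.rpow_natCast, ← Real.rpow_mul (Finset.sum_nonneg fun _ _ => by positivity)]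
  congr 1; push_cast; ring

lemma aux_hull (p γ : ℝ) (hp : 2 ≤ p) {d n : ℕ} (x : Fin n → Fin d → ℝ)
    (hγ : ∀ i, pnorm p (x i) ≤ γ) (μ : Fin d → ℝ) (hμ : μ ∈ convexHull ℝ (Set.range x)) :
    pnorm p μ ≤ γ := by
  have hc : Convex ℝ {v : Fin d → ℝ | pnorm p v ≤ γ} := by
    intro u hu v hv a b ha hb hab
    have hu' : pnorm p u ≤ γ := hu
    have hv' : pnorm p v ≤ γ := hv
    show pnorm p _ ≤ γ
    refine (aux_add p hp _ _).trans ?_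
    rw [aux_smul p hp, aux_smul p hp, abs_of_nonneg ha, abs_of_nonneg hb]
    calc a * pnorm p u + b * pnorm p v ≤ a * γ + b * γ := by gcongr
      _ = γ := by rw [← add_mul, hab, one_mul]
  exact convexHull_min (by rintro _ ⟨i, rfl⟩; exact hγ i) hc hμ

lemma aux_choice {d n : ℕ} (x : Fin n → Fin d → ℝ) (c : Fin d → ℝ)
    (μ : Fin d → ℝ) (hμ : μ ∈ convexHull ℝ (Set.range x)) :
    ∃ i, ∑ j, c j * (μ - x i) j ≤ 0 := by
  by_contra! hcon
  have hc : Convex ℝ {v : Fin d → ℝ | c ⬝ᵥ v < c ⬝ᵥ μ} :=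
    convex_halfSpace_lt ⟨fun u v => dotProduct_add _ _ _, fun a v => dotProduct_smul _ _ _⟩ _
  have : μ ∈ {v : Fin d → ℝ | c ⬝ᵥ v < c ⬝ᵥ μ} := by
    refine convexHull_min ?_ hc hμ
    rintro _ ⟨i, rfl⟩
    have h1 : 0 < c ⬝ᵥ (μ - x i) := hcon i
    rw [dotProduct_sub] at h1
    show c ⬝ᵥ x i < c ⬝ᵥ μ
    linarith
  exact lt_irrefl (c ⬝ᵥ μ) this

/-- **Approximate Carathéodory theorem (p-norm version).** Let
`X = {x 1, …, x n} ⊂ ℝ^d`, let `2 ≤ p < ∞`, let `γ` bound the `p`-norms of the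
vectors of `X` (in particular one may take `γ = max_i ‖x i‖_p`), and let `ε > 0`.
Then for every `μ ∈ conv(X)` and every integer `m ≥ 4pγ²/ε²` there exists an
`m`-uniform vector `μ' = (1/m) ∑_{j=1}^m x (f j)` (given by a multiset
`{f 1, …, f m}` of indices) with `‖μ − μ'‖_p ≤ ε`. -/
theorem approx_caratheodory (d n : ℕ) (x : Fin n → Fin d → ℝ)
    (p γ ε : ℝ) (hp : 2 ≤ p) (hε : 0 < ε)
    (hγ : ∀ i, pnorm p (x i) ≤ γ)
    (μ : Fin d → ℝ) (hμ : μ ∈ convexHull ℝ (Set.range x))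
    (m : ℕ) (hm : 4 * p * γ ^ 2 / ε ^ 2 ≤ (m : ℝ)) :
    ∃ f : Fin m → Fin n,
      pnorm p (μ - (m : ℝ)⁻¹ • ∑ j, x (f j)) ≤ ε := by
  have hp0 : 0 < p := by linarith
  have hμγ := aux_hull p γ hp x hγ μ hμ
  have hγ0 : 0 ≤ γ := (aux_nonneg p μ).trans hμγ
  rw [div_le_iff₀ (by positivity)] at hm
  obtain ⟨i0, -⟩ := aux_choice x 0 μ hμ
  rcases Nat.eq_zero_or_pos m with h0 | hmpos
  · subst h0
    refine ⟨fun _ => i0, ?_⟩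
    have : γ ^ 2 ≤ 0 := by
      simp only [Nat.cast_zero, zero_mul] at hm
      by_contra! hcon
      have : 0 < 4 * p * γ ^ 2 := by positivity
      linarith
    have hg : γ = 0 := by nlinarith [sq_nonneg γ, pow_eq_zero_iff (two_ne_zero) (a := γ)]
    simp
    linarith
  have hmr : (0:ℝ) < m := by exact_mod_cast hmpos
  rcases eq_or_lt_of_le hγ0 with hg | hg
  · refine ⟨fun _ => i0, ?_⟩
    have e : μ - (m : ℝ)⁻¹ • ∑ j : Fin m, x i0 = μ + (-1 : ℝ) • x i0 := by
      rw [Finset.sum_const, Finset.card_univ, Fintype.card_fin, ← Nat.cast_smul_eq_nsmul ℝ,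
        smul_smul, inv_mul_cancel₀ hmr.ne']
      simp [sub_eq_add_neg]
    rw [e]
    refine (aux_add p hp _ _).trans ?_
    rw [aux_smul p hp]
    have := hγ i0
    simp only [abs_neg, abs_one, one_mul]
    linarith
  have hy : ∀ i, pnorm p (μ - x i) ≤ 2 * γ := fun i => by
    have e : μ - x i = μ + (-1 : ℝ) • x i := by simp [sub_eq_add_neg]
    rw [e]
    refine (aux_add p hp _ _).trans ?_
    rw [aux_smul p hp]
    have := hγ i
    simp only [abs_neg, abs_one, one_mul]
    linarith
  set δ : ℝ := (4 * m * γ ^ 2) ^ (p / 2) with hδd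
  have hδ : 0 < δ := by positivity
  have hδ2 : δ ^ (2 / p) = 4 * m * γ ^ 2 := by
    rw [hδd, ← Real.rpow_mul (by positivity)]
    have : p / 2 * (2 / p) = 1 := by field_simp
    rw [this, Real.rpow_one]
  have key : ∀ k : ℕ, ∃ f : Fin k → Fin n,
      (δ + ∑ j, |(∑ i, (μ - x (f i))) j| ^ p) ^ (2 / p) ≤
        4 * m * γ ^ 2 + k * ((p - 1) * (2 * γ) ^ 2) := by
    intro k
    induction k with
    | zero =>
      refine ⟨Fin.elim0, ?_⟩
      simp [Real.zero_rpow hp0.ne', hδ2]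
    | succ k ih =>
      obtain ⟨f, hf⟩ := ih
      set z := ∑ i, (μ - x (f i)) with hz
      obtain ⟨i, hi⟩ := aux_choice x (fun j => |z j| ^ (p - 2) * z j) μ hμ
      refine ⟨Fin.snoc f i, ?_⟩
      have := aux_smooth p δ hp hδ z (μ - x i) hi
      rw [aux_sq] at this
      have h2 : pnorm p (μ - x i) ^ 2 ≤ (2 * γ) ^ 2 :=
        pow_le_pow_left₀ (aux_nonneg _ _) (hy i) 2
      have h3 : (p - 1) * pnorm p (μ - x i) ^ 2 ≤ (p - 1) * (2 * γ) ^ 2 :=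
        mul_le_mul_of_nonneg_left h2 (by linarith)
      rw [Fin.sum_univ_castSucc]
      simp only [Fin.snoc_castSucc, Fin.snoc_last, ← hz]
      simp only [Pi.add_apply]
      push_cast
      linarith
  obtain ⟨f, hf⟩ := key m
  refine ⟨f, ?_⟩
  have h1 : pnorm p (∑ i, (μ - x (f i))) ^ 2 ≤ (m * ε) ^ 2 := by
    rw [← aux_sq]
    have hS : 0 ≤ ∑ j, |(∑ i, (μ - x (f i))) j| ^ p :=
      Finset.sum_nonneg fun _ _ => by positivity
    refine (Real.rpow_le_rpow hS (le_add_of_nonneg_left hδ.le) (by positivity)).trans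
      (hf.trans ?_)
    have := mul_le_mul_of_nonneg_left hm hmr.le
    nlinarith
  have h2 := (pow_le_pow_iff_left₀ (aux_nonneg _ _) (by positivity) two_ne_zero).mp h1
  have e : μ - (m : ℝ)⁻¹ • ∑ j, x (f j) = (m : ℝ)⁻¹ • ∑ i, (μ - x (f i)) := by
    rw [Finset.sum_sub_distrib, Finset.sum_const, Finset.card_univ, Fintype.card_fin,
      ← Nat.cast_smul_eq_nsmul ℝ, smul_sub, smul_smul, inv_mul_cancel₀ hmr.ne', one_smul]
  rw [e, aux_smul p hp, abs_of_pos (by positivity), inv_mul_le_iff₀ hmr]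
  exact h2
end

section
/- Let X = {x_1, x_2, …, x_n} ⊂ ℝ^d be a finite set of vectors with max_{x ∈ X} ‖x‖_∞ ≤ 1, and let ε > 0. Then for every μ ∈ conv(X) and every integer m > 2 ln(2d)/ε², there exists an m-uniform vector μ' ∈ conv(X) such that ‖μ − μ'‖_∞ ≤ ε. -/
open Finset

theorem hoeff_aux {n : ℕ} (w : Fin n → ℝ) (hw : ∀ i, 0 ≤ w i) (hs : ∑ i, w i = 1)
    (z : Fin n → ℝ) (hz : ∀ i, |z i| ≤ 1) (t : ℝ) :
    ∑ i, w i * Real.exp (t * (z i - ∑ k, w k * z k)) ≤ Real.exp (t ^ 2 / 2) := by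
  let P : MeasureTheory.Measure (Fin n) :=
    ∑ i, ENNReal.ofReal (w i) • MeasureTheory.Measure.dirac i
  have hI : ∀ g : Fin n → ℝ, ∫ a, g a ∂P = ∑ i, w i * g i := by
    intro g
    rw [MeasureTheory.integral_finsetSum_measure]
    · refine Finset.sum_congr rfl fun i _ => ?_
      rw [MeasureTheory.integral_smul_measure, MeasureTheory.integral_dirac,
        ENNReal.toReal_ofReal (hw i), smul_eq_mul]
    · intro i _
      exact (MeasureTheory.integrable_dirac (by simp)).smul_measure ENNReal.ofReal_ne_top
  haveI : MeasureTheory.IsProbabilityMeasure P := ⟨by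
    simp only [P, MeasureTheory.Measure.coe_finsetSum, Finset.sum_apply,
      MeasureTheory.Measure.smul_apply, MeasureTheory.measure_univ, smul_eq_mul, mul_one]
    rw [← ENNReal.ofReal_sum_of_nonneg (fun i _ => hw i), hs, ENNReal.ofReal_one]⟩
  have h := (ProbabilityTheory.hasSubgaussianMGF_of_mem_Icc (μ := P) (X := z) (a := -1) (b := 1)
    (measurable_of_finite z).aemeasurable
    (Filter.Eventually.of_forall fun i => abs_le.1 (hz i))).mgf_le t
  rw [ProbabilityTheory.mgf, hI, hI] at h
  refine h.trans (le_of_eq ?_)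
  norm_num

theorem greedy_aux {n : ℕ} {J : Type} [Fintype J] (w : Fin n → ℝ) (hw : ∀ i, 0 ≤ w i)
    (hs : ∑ i, w i = 1) (y : Fin n → J → ℝ) (C : ℝ) (hC : 0 ≤ C)
    (hy : ∀ j, ∑ i, w i * Real.exp (y i j) ≤ C) (k : ℕ) :
    ∃ f : Fin k → Fin n, ∑ j, Real.exp (∑ i, y (f i) j) ≤ Fintype.card J * C ^ k := by
  induction k with
  | zero => exact ⟨Fin.elim0, by simp⟩
  | succ k ih =>
    obtain ⟨f, hf⟩ := ih
    by_contra! hcon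
    have h1 : ∀ i, (Fintype.card J : ℝ) * C ^ (k+1)
        < ∑ j, Real.exp (y i j) * Real.exp (∑ l, y (f l) j) := by
      intro i
      have := hcon (Fin.cons i f)
      simpa [Fin.sum_univ_succ, Real.exp_add] using this
    have h2 : ∑ i, w i * ∑ j, Real.exp (y i j) * Real.exp (∑ l, y (f l) j)
        ≤ (Fintype.card J : ℝ) * C ^ (k+1) := by
      calc _ = ∑ j, (∑ i, w i * Real.exp (y i j)) * Real.exp (∑ l, y (f l) j) := by
            simp only [Finset.mul_sum, Finset.sum_mul]
            rw [Finset.sum_comm]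
            simp only [mul_assoc]
        _ ≤ ∑ j, C * Real.exp (∑ l, y (f l) j) := by
            gcongr with j _
            exact hy j
        _ = C * ∑ j, Real.exp (∑ l, y (f l) j) := by rw [Finset.mul_sum]
        _ ≤ C * (Fintype.card J * C ^ k) := by gcongr
        _ = _ := by ring
    have h3 : ∑ i, w i * ((Fintype.card J : ℝ) * C ^ (k+1)) <
        ∑ i, w i * ∑ j, Real.exp (y i j) * Real.exp (∑ l, y (f l) j) := by
      apply Finset.sum_lt_sum
      · intro i _
        exact mul_le_mul_of_nonneg_left (h1 i).le (hw i)
      · by_contra! hc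
        have : ∑ i, w i = 0 := Finset.sum_eq_zero fun i hi => by
          by_contra hne
          have := hc i hi
          have hp := lt_of_le_of_ne (hw i) (Ne.symm hne)
          exact absurd (mul_lt_mul_of_pos_left (h1 i) hp) (not_lt.2 this)
        linarith
    rw [← Finset.sum_mul, hs, one_mul] at h3
    linarith

/-- **Approximate Carathéodory theorem (∞-norm version).** Let
`X = {x 1, …, x n} ⊂ ℝ^d` with `max_i ‖x i‖_∞ ≤ 1` and let `ε > 0`. Then for
every `μ ∈ conv(X)` and every integer `m > 2 ln(2d)/ε²` there exists an
`m`-uniform vector `μ' = (1/m) ∑_{j=1}^m x (f j)` with `‖μ − μ'‖_∞ ≤ ε`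
(i.e., `|μ j − μ' j| ≤ ε` for every coordinate `j`). -/
theorem approx_caratheodory_infty (d n : ℕ) (x : Fin n → Fin d → ℝ) (ε : ℝ)
    (hx : ∀ i j, |x i j| ≤ 1) (hε : 0 < ε)
    (μ : Fin d → ℝ) (hμ : μ ∈ convexHull ℝ (Set.range x))
    (m : ℕ) (hm : 2 * Real.log (2 * d) / ε ^ 2 < (m : ℝ)) :
    ∃ f : Fin m → Fin n,
      ∀ j, |μ j - ((m : ℝ)⁻¹ • ∑ i, x (f i)) j| ≤ ε := by
  obtain ⟨w, hw, hs, hwμ⟩ : ∃ w : Fin n → ℝ, (∀ i, 0 ≤ w i) ∧ ∑ i, w i = 1 ∧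
      ∑ i, w i • x i = μ := by
    rw [convexHull_range_eq_exists_affineCombination] at hμ
    obtain ⟨s, w, h0, h1, h2⟩ := hμ
    rw [Finset.affineCombination_eq_linear_combination _ _ _ h1] at h2
    refine ⟨fun i => if i ∈ s then w i else 0, ?_, ?_, ?_⟩
    · intro i
      dsimp only
      split_ifs with h
      · exact h0 i h
      · exact le_rfl
    · simpa using h1
    · simpa [ite_smul] using h2
  have hμj : ∀ j, ∑ k, w k * x k j = μ j := fun j => by
    rw [← hwμ]; simp
  obtain ⟨f, hf⟩ := greedy_aux (J := Fin d × Bool) w hw hs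
    (fun i p => (if p.2 then ε else -ε) * (x i p.1 - μ p.1)) (Real.exp (ε ^ 2 / 2))
    (Real.exp_pos _).le (by
      rintro ⟨j, b⟩
      have := hoeff_aux w hw hs (fun i => x i j) (fun i => hx i j) (if b then ε else -ε)
      rw [hμj] at this
      refine this.trans (le_of_eq ?_)
      cases b <;> simp) m
  refine ⟨f, fun j => ?_⟩
  have hd : (1 : ℝ) ≤ d := by exact_mod_cast (Fin.pos j)
  have hlog : 0 < Real.log (2 * d) := Real.log_pos (by linarith)
  have hm0 : (0 : ℝ) < m := lt_trans (by positivity) hm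
  rw [div_lt_iff₀ (by positivity)] at hm
  have key : ∀ b : Bool, (if b then ε else -ε) * (∑ i, x (f i) j - m * μ j) ≤ m * ε ^ 2 := by
    intro b
    have h1 := (Finset.single_le_sum (f := fun p : Fin d × Bool =>
      Real.exp (∑ i, (if p.2 then ε else -ε) * (x (f i) p.1 - μ p.1)))
      (fun p _ => (Real.exp_pos _).le) (Finset.mem_univ (j, b))).trans hf
    have h2 : ((Fintype.card (Fin d × Bool) : ℕ) : ℝ) * Real.exp (ε ^ 2 / 2) ^ m
        = Real.exp (Real.log (2 * d) + m * (ε ^ 2 / 2)) := by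
      rw [Real.exp_add, Real.exp_log (by linarith), Real.exp_nat_mul]
      simp [mul_comm]
    rw [h2, Real.exp_le_exp, ← Finset.mul_sum, Finset.sum_sub_distrib] at h1
    simp only [Finset.sum_const, Finset.card_univ, Fintype.card_fin, nsmul_eq_mul] at h1
    linarith
  have k1 := key true
  have k2 := key false
  simp only [if_true, Bool.false_eq_true, if_false] at k1 k2
  have e : μ j - ((m : ℝ)⁻¹ • ∑ i, x (f i)) j = -((∑ i, x (f i) j - m * μ j) / m) := by
    simp only [Pi.smul_apply, Finset.sum_apply, smul_eq_mul]
    field_simp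
    ring
  rw [e, abs_neg, abs_div, abs_of_pos hm0, div_le_iff₀ hm0, abs_le]
  constructor
  · refine le_of_mul_le_mul_left ?_ hε
    nlinarith
  · refine le_of_mul_le_mul_left ?_ hε
    nlinarith
end

section
/- Let A, B ∈ [−1,1]^{n×n} be the payoff matrices of a bimatrix game and let C = A + B. Suppose x, y ∈ Δ^n and π_1, π_2 ∈ [−1,1] satisfy (x^T B)_j ≤ π_2 for all j ∈ [n], (A y)_i ≤ π_1 for all i ∈ [n], and x^T C y ≥ π_1 + π_2 − ε. Then (x, y) is an ε-Nash equilibrium of the game (A, B). -/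
open Finset Matrix

/-- `(x, y)` is an `ε`-Nash equilibrium of the bimatrix game `(A, B)`:
`xᵀAy ≥ (Ay)_i − ε` for all rows `i`, and `xᵀBy ≥ (xᵀB)_j − ε` for all
columns `j`. -/
def IsEpsNash {n : ℕ} (A B : Matrix (Fin n) (Fin n) ℝ)
    (x y : Fin n → ℝ) (ε : ℝ) : Prop :=
  (∀ i, A.mulVec y i - ε ≤ x ⬝ᵥ A.mulVec y) ∧
  (∀ j, vecMul x B j - ε ≤ x ⬝ᵥ B.mulVec y)

/-- **Near-optimal solutions of the Mangasarian–Stone bilinear program are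
approximate Nash equilibria.** Let `A, B ∈ [−1,1]^{n×n}`, `C = A + B`. If
`x, y ∈ Δ^n` and `π₁, π₂ ∈ [−1,1]` satisfy `(xᵀB)_j ≤ π₂` for all `j`,
`(Ay)_i ≤ π₁` for all `i`, and `xᵀCy ≥ π₁ + π₂ − ε`, then `(x, y)` is an
`ε`-Nash equilibrium of `(A, B)`. -/
theorem bilinear_near_opt_is_eps_nash (n : ℕ)
    (A B : Matrix (Fin n) (Fin n) ℝ)
    (hA : ∀ i j, A i j ∈ Set.Icc (-1 : ℝ) 1)
    (hB : ∀ i j, B i j ∈ Set.Icc (-1 : ℝ) 1)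
    (x y : Fin n → ℝ) (ε π₁ π₂ : ℝ)
    (hx : x ∈ stdSimplex ℝ (Fin n)) (hy : y ∈ stdSimplex ℝ (Fin n))
    (hπ₁ : π₁ ∈ Set.Icc (-1 : ℝ) 1) (hπ₂ : π₂ ∈ Set.Icc (-1 : ℝ) 1)
    (hcol : ∀ j, vecMul x B j ≤ π₂)
    (hrow : ∀ i, A.mulVec y i ≤ π₁)
    (hobj : π₁ + π₂ - ε ≤ x ⬝ᵥ (A + B).mulVec y) :
    IsEpsNash A B x y ε := by
  have key : ∀ (u v : Fin n → ℝ) (c : ℝ), u ∈ stdSimplex ℝ (Fin n) → (∀ i, v i ≤ c) →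
      u ⬝ᵥ v ≤ c := by
    intro u v c hu hv
    calc u ⬝ᵥ v = ∑ i, u i * v i := rfl
      _ ≤ ∑ i, u i * c := Finset.sum_le_sum fun i _ => mul_le_mul_of_nonneg_left (hv i) (hu.1 i)
      _ = c := by rw [← Finset.sum_mul, hu.2, one_mul]
  have h1 := key x _ π₁ hx hrow
  have h2 := key y _ π₂ hy hcol
  rw [dotProduct_comm, ← dotProduct_mulVec] at h2
  rw [add_mulVec, dotProduct_add] at hobj
  exact ⟨fun i => by linarith [hrow i], fun j => by linarith [hcol j]⟩
end

section
/- Mangasarian–Stone equivalence: let A, B ∈ [−1,1]^{n×n} be the payoff matrices of a bimatrix game and C = A + B, and consider the bilinear program maximizing x^T C y − π_1 − π_2 over x, y ∈ Δ^n and π_1, π_2 ∈ [−1,1] subject to (x^T B)_j ≤ π_2 for all j and (A y)_i ≤ π_1 for all i. Then: (i) the optimal value of this program is 0; and (ii) a pair (x̂, ŷ) with x̂, ŷ ∈ Δ^n is a Nash equilibrium of (A, B) if and only if there exist π̂_1, π̂_2 ∈ [−1,1] such that (x̂, ŷ, π̂_1, π̂_2) is an optimal solution; moreover in that case π̂_1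 = x̂^T A ŷ and π̂_2 = x̂^T B ŷ. -/
open Finset Matrix

/-- Feasibility for the Mangasarian–Stone bilinear program associated with the
bimatrix game `(A, B)`: `x, y ∈ Δ^n`, `π₁, π₂ ∈ [−1,1]`, `(xᵀB)_j ≤ π₂` for
all `j` and `(Ay)_i ≤ π₁` for all `i`. -/
def MSFeasible {n : ℕ} (A B : Matrix (Fin n) (Fin n) ℝ)
    (x y : Fin n → ℝ) (π₁ π₂ : ℝ) : Prop :=
  x ∈ stdSimplex ℝ (Fin n) ∧ y ∈ stdSimplex ℝ (Fin n) ∧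
  π₁ ∈ Set.Icc (-1 : ℝ) 1 ∧ π₂ ∈ Set.Icc (-1 : ℝ) 1 ∧
  (∀ j, vecMul x B j ≤ π₂) ∧ (∀ i, A.mulVec y i ≤ π₁)

/-- The objective `xᵀCy − π₁ − π₂` of the Mangasarian–Stone bilinear program,
where `C = A + B`. -/
def MSObj {n : ℕ} (A B : Matrix (Fin n) (Fin n) ℝ)
    (x y : Fin n → ℝ) (π₁ π₂ : ℝ) : ℝ :=
  x ⬝ᵥ (A + B).mulVec y - π₁ - π₂

/-- `(x, y)` is a (exact) Nash equilibrium of the bimatrix game `(A, B)`. -/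
def IsNash {n : ℕ} (A B : Matrix (Fin n) (Fin n) ℝ) (x y : Fin n → ℝ) : Prop :=
  (∀ i, A.mulVec y i ≤ x ⬝ᵥ A.mulVec y) ∧
  (∀ j, vecMul x B j ≤ x ⬝ᵥ B.mulVec y)

def ScarfPrim {V I : Type} (R : I → V → ℕ) (S : Finset V) : Prop :=
  ∀ y, ∃ i, ∀ s ∈ S, R i y ≤ R i s

lemma scarf_struct {V I : Type} [Fintype I] [DecidableEq V] [DecidableEq I]
    (R : I → V → ℕ) (hR : ∀ i, Function.Injective (R i))
    (P : Finset V) (hP : P.card + 1 = Fintype.card I)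
    (m : I → V) (hmP : ∀ k, m k ∈ P) (hm : ∀ k, ∀ p ∈ P, R k (m k) ≤ R k p)
    (w : V) (hw : w ∉ P) (hprim : ScarfPrim R (insert w P)) :
    ∃ i, R i w < R i (m i) ∧ (∀ k, k ≠ i → R k (m k) < R k w) ∧
      (∀ k l, k ≠ i → l ≠ i → m k = m l → k = l) ∧ ∃ j, j ≠ i ∧ m j = m i := by
  obtain ⟨i, hi⟩ := hprim w
  choose f hf using hprim
  have hfm : ∀ p ∈ P, m (f p) = p := by
    intro p hp
    apply hR (f p)
    apply le_antisymm (hm _ _ hp)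
    exact hf p _ (mem_insert_of_mem (hmP _))
  have hfi : ∀ p ∈ P, f p ≠ i := by
    intro p hp h
    have h1 := hf p w (mem_insert_self _ _)
    have h2 := hi p (mem_insert_of_mem hp)
    rw [h] at h1
    have := hR i (le_antisymm h1 h2)
    exact hw (this ▸ hp)
  have hinj : Set.InjOn f P := by
    intro p hp q hq h
    rw [← hfm p hp, ← hfm q hq, h]
  have himg : P.image f = univ.erase i := by
    apply Finset.eq_of_subset_of_card_le
    · intro k hk
      obtain ⟨p, hp, rfl⟩ := mem_image.1 hk
      simp [hfi p hp]
    · rw [card_image_of_injOn hinj, card_erase_of_mem (mem_univ _), card_univ]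
      omega
  have hsurj : ∀ k, k ≠ i → ∃ p ∈ P, f p = k := by
    intro k hk
    have : k ∈ P.image f := by rw [himg]; simp [hk]
    simpa using this
  have hne : ∀ k, m k ≠ w := fun k h => hw (h ▸ hmP k)
  refine ⟨i, ?_, ?_, ?_, ?_⟩
  · exact lt_of_le_of_ne (hi _ (mem_insert_of_mem (hmP _))) (fun h => hne i (hR i h).symm)
  · intro k hk
    obtain ⟨p, hp, rfl⟩ := hsurj k hk
    refine lt_of_le_of_ne ?_ (fun h => hne _ (hR _ h))
    rw [hfm p hp]
    exact hf p w (mem_insert_self _ _)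
  · intro k l hk hl h
    obtain ⟨p, hp, rfl⟩ := hsurj k hk
    obtain ⟨q, hq, rfl⟩ := hsurj l hl
    rw [hfm p hp, hfm q hq] at h
    rw [h]
  · exact ⟨f (m i), hfi _ (hmP i), hfm _ (hmP i)⟩

lemma scarf_uniq {V I : Type} [DecidableEq V]
    (R : I → V → ℕ) (hR : ∀ i, Function.Injective (R i))
    (P : Finset V) (m : I → V) (hmP : ∀ k, m k ∈ P) (i : I)
    (z w : V) (hz : ScarfPrim R (insert z P)) (hw : ScarfPrim R (insert w P))
    (hz1 : ∀ k, k ≠ i → R k (m k) < R k z) (hw1 : ∀ k, k ≠ i → R k (m k) < R k w) : w = z := by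
  have key : ∀ z w : V, ScarfPrim R (insert z P) → (∀ k, k ≠ i → R k (m k) < R k w) →
      R i w ≤ R i z := by
    intro z w hz hw1
    obtain ⟨l, hl⟩ := hz w
    by_cases h : l = i
    · subst h; exact hl z (mem_insert_self _ _)
    · have := hl (m l) (mem_insert_of_mem (hmP l))
      have := hw1 l h
      omega
  exact hR i (le_antisymm (key z w hz hw1) (key w z hw hz1))

lemma scarf_two {V I : Type} [Fintype V] [Fintype I] [DecidableEq V] [DecidableEq I]
    (R : I → V → ℕ) (hR : ∀ i, Function.Injective (R i))
    (P : Finset V) (hP : P.card + 1 = Fintype.card I) (hne : P.Nonempty)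
    (hQ : ∀ j, ∃ y, ∀ k, k ≠ j → ∃ p ∈ P, R k p < R k y)
    (z : V) (hz : z ∉ P) (hprim : ScarfPrim R (insert z P)) :
    ∃ z', z' ≠ z ∧ z' ∉ P ∧ ScarfPrim R (insert z' P) ∧
      ∀ w, w ∉ P → ScarfPrim R (insert w P) → w = z ∨ w = z' := by
  have hmex : ∀ k, ∃ q ∈ P, ∀ p ∈ P, R k q ≤ R k p := fun k => exists_min_image P (R k) hne
  choose m hmP hm using hmex
  obtain ⟨i, hi1, hi2, hi3, j, hji, hmj⟩ := scarf_struct R hR P hP m hmP hm z hz hprim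
  classical
  have hQne : (univ.filter (fun y => ∀ k, k ≠ j → R k (m k) < R k y)).Nonempty := by
    obtain ⟨y, hy⟩ := hQ j
    refine ⟨y, ?_⟩
    simp only [mem_filter, mem_univ, true_and]
    intro k hk
    obtain ⟨p, hp, hlt⟩ := hy k hk
    exact lt_of_le_of_lt (hm k p hp) hlt
  obtain ⟨z', hz', hmax⟩ := exists_max_image _ (R j) hQne
  simp only [mem_filter, mem_univ, true_and] at hz' hmax
  have hlt : R j z' < R j (m j) := by
    obtain ⟨l, hl⟩ := hprim z'
    by_cases h : l = j
    · subst h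
      refine lt_of_le_of_ne (hl _ (mem_insert_of_mem (hmP _))) (fun h => ?_)
      have h1 := hR _ h
      have h2 := hz' i hji.symm
      rw [h1, hmj] at h2
      exact lt_irrefl _ h2
    · have := hl (m l) (mem_insert_of_mem (hmP l))
      have := hz' l h
      omega
  have hz'P : z' ∉ P := fun h => by
    have := hm j z' h
    omega
  have hz'prim : ScarfPrim R (insert z' P) := by
    intro y
    by_contra hcon
    push Not at hcon
    have hy : ∀ k, k ≠ j → R k (m k) < R k y := by
      intro k hk
      obtain ⟨s, hs, hsy⟩ := hcon k
      rcases mem_insert.1 hs with rfl | hs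
      · exact (hz' k hk).trans hsy
      · exact lt_of_le_of_lt (hm k s hs) hsy
    have h1 := hmax y hy
    obtain ⟨s, hs, h2⟩ := hcon j
    rcases mem_insert.1 hs with rfl | hs
    · omega
    · have := hm j s hs
      omega
  refine ⟨z', ?_, hz'P, hz'prim, ?_⟩
  · rintro rfl
    have := hi2 j hji
    omega
  · intro w hw hwprim
    obtain ⟨i', h1, h2, h3, _⟩ := scarf_struct R hR P hP m hmP hm w hw hwprim
    by_cases hii : i' = i
    · subst hii
      exact Or.inl (scarf_uniq R hR P m hmP _ z w hprim hwprim hi2 h2)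
    · by_cases hij : i' = j
      · subst hij
        exact Or.inr (scarf_uniq R hR P m hmP _ z' w hz'prim hwprim hz' h2)
      · exact absurd (h3 j i (Ne.symm hij) (Ne.symm hii) hmj) hji

/-- Scarf's lemma. -/
lemma scarf_main {V I : Type} [Fintype V] [Fintype I] [DecidableEq V] [DecidableEq I]
    [Nonempty I]
    (R : I → V → ℕ) (hR : ∀ i, Function.Injective (R i)) (e : I → V)
    (he1 : ∀ i v, R i (e i) ≤ R i v)
    (he2 : ∀ i j v, j ≠ i → (∀ l, v ≠ e l) → R i v < R i (e j))
    (hT : ∃ v, ∀ l, v ≠ e l) (c : V → I) (hc : ∀ i, c (e i) = i) :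
    ∃ S : Finset V, ScarfPrim R S ∧ S.image c = univ := by
  classical
  by_contra hcon
  push Not at hcon
  obtain ⟨i0⟩ := ‹Nonempty I›
  have heinj : Function.Injective e := fun a b h => by rw [← hc a, ← hc b, h]
  let PP : Finset (Finset V) := univ.filter (fun S => ScarfPrim R S ∧ S.card = Fintype.card I)
  let DD : Finset (Finset V) :=
    univ.filter (fun P => P.card + 1 = Fintype.card I ∧ P.image c = univ.erase i0)
  have hcount := Finset.sum_card_bipartiteAbove_eq_sum_card_bipartiteBelow
    (s := PP) (t := DD) (fun S P => P ⊆ S)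
  -- a member of PP containing P is insert z P
  have hins : ∀ S P : Finset V, S.card = Fintype.card I → P.card + 1 = Fintype.card I → P ⊆ S →
      ∃ z, z ∉ P ∧ S = insert z P := by
    intro S P h1 h2 h3
    have : (S \ P).card = 1 := by
      rw [card_sdiff_of_subset h3]; omega
    obtain ⟨z, hz⟩ := card_eq_one.1 this
    have hz' : z ∈ S \ P := by rw [hz]; simp
    refine ⟨z, (mem_sdiff.1 hz').2, ?_⟩
    rw [insert_eq, ← hz, sdiff_union_of_subset h3]
  have hL : ∀ S ∈ PP, Even (bipartiteAbove (fun S P => P ⊆ S) DD S).card := by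
    intro S hS
    simp only [PP, mem_filter, mem_univ, true_and] at hS
    rcases (bipartiteAbove (fun S P => P ⊆ S) DD S).eq_empty_or_nonempty with h0 | ⟨P, hP⟩
    · rw [h0]; simp
    · simp only [bipartiteAbove, DD, mem_filter, mem_univ, true_and] at hP
      obtain ⟨⟨hPc, hPi⟩, hPS⟩ := hP
      obtain ⟨z, hzP, rfl⟩ := hins S P hS.2 hPc hPS
      have hnc := hcon _ hS.1
      have hcz : c z ≠ i0 := by
        intro h
        apply hnc
        rw [image_insert, hPi, h, insert_erase (mem_univ _)]
      have hczm : c z ∈ P.image c := by rw [hPi]; simp [hcz]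
      obtain ⟨z', hz'P, hzz'⟩ := mem_image.1 hczm
      have hcinj : Set.InjOn c P := by
        apply injOn_of_card_image_eq
        rw [hPi, card_erase_of_mem (mem_univ _), card_univ]; omega
      have hne : z' ≠ z := fun h => hzP (h ▸ hz'P)
      have heq : bipartiteAbove (fun S P => P ⊆ S) DD (insert z P)
          = {P, (insert z P).erase z'} := by
        ext Q
        simp only [bipartiteAbove, DD, mem_filter, mem_univ, true_and, mem_insert, mem_singleton]
        constructor
        · rintro ⟨⟨hQc, hQi⟩, hQS⟩
          obtain ⟨w, hwQ, hw⟩ := hins _ Q hS.2 hQc hQS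
          have hQe : Q = (insert z P).erase w := by rw [hw, erase_insert hwQ]
          have hwm : w ∈ insert z P := by rw [hw]; simp
          rcases mem_insert.1 hwm with rfl | hwP
          · left; rw [hQe, erase_insert hzP]
          · right
            have hcw : c w ∈ Q.image c := by
              rw [hQi, ← hPi]; exact mem_image_of_mem c hwP
            obtain ⟨q, hq, hqw⟩ := mem_image.1 hcw
            have hqS := hQS hq
            have hqnw : q ≠ w := fun h => hwQ (h ▸ hq)
            rcases mem_insert.1 hqS with rfl | hqP
            · have : w = z' := hcinj hwP hz'P (by rw [hzz', hqw])
              rw [hQe, this]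
            · exact absurd (hcinj hqP hwP hqw) hqnw
        · rintro (rfl | rfl)
          · exact ⟨⟨hPc, hPi⟩, hPS⟩
          · refine ⟨⟨?_, ?_⟩, erase_subset _ _⟩
            · rw [card_erase_of_mem (mem_insert_of_mem hz'P), card_insert_of_notMem hzP]
              omega
            · rw [← hPi]
              ext k
              simp only [mem_image, mem_erase, mem_insert]
              constructor
              · rintro ⟨q, ⟨h1, rfl | h2⟩, rfl⟩
                · exact ⟨z', hz'P, hzz'⟩
                · exact ⟨q, h2, rfl⟩
              · rintro ⟨q, hq, rfl⟩
                by_cases hqz : q = z'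
                · exact ⟨z, ⟨hne.symm, Or.inl rfl⟩, by rw [hqz, hzz']⟩
                · exact ⟨q, ⟨hqz, Or.inr hq⟩, rfl⟩
      rw [heq, card_pair]
      · exact even_two
      · intro h
        rw [h] at hz'P
        simp at hz'P
  let P0 : Finset V := (univ.erase i0).image e
  have hP0c : P0.card + 1 = Fintype.card I := by
    rw [card_image_of_injective _ heinj, card_erase_of_mem (mem_univ _), card_univ]
    have : 0 < Fintype.card I := Fintype.card_pos_iff.2 ⟨i0⟩
    omega
  have hP0D : P0 ∈ DD := by
    simp only [DD, mem_filter, mem_univ, true_and]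
    refine ⟨hP0c, ?_⟩
    rw [image_image]
    have : c ∘ e = id := funext hc
    rw [this, image_id]
  have hD1 : ∀ P ∈ DD, P ≠ P0 → Even (bipartiteBelow (fun S P => P ⊆ S) PP P).card := by
    intro P hP hPne
    simp only [DD, mem_filter, mem_univ, true_and] at hP
    obtain ⟨hPc, hPi⟩ := hP
    have hex : ∃ t ∈ P, ∀ l, t ≠ e l := by
      by_contra hno
      push Not at hno
      apply hPne
      apply Finset.eq_of_subset_of_card_le
      · intro t ht
        obtain ⟨l, rfl⟩ := hno t ht
        apply mem_image_of_mem
        rw [← hPi, ← hc l]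
        simpa [hc] using mem_image_of_mem c ht
      · omega
    obtain ⟨t, htP, ht⟩ := hex
    rcases (bipartiteBelow (fun S P => P ⊆ S) PP P).eq_empty_or_nonempty with h0 | ⟨S, hS⟩
    · rw [h0]; simp
    · simp only [bipartiteBelow, PP, mem_filter, mem_univ, true_and] at hS
      obtain ⟨⟨hS1, hS2⟩, hPS⟩ := hS
      obtain ⟨z, hzP, rfl⟩ := hins S P hS2 hPc hPS
      obtain ⟨z', hne, hz'P, hz'prim, hall⟩ := scarf_two R hR P hPc ⟨t, htP⟩
        (fun j => ⟨e j, fun k hk => ⟨t, htP, he2 k j t hk.symm ht⟩⟩) z hzP hS1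
      have heq : bipartiteBelow (fun S P => P ⊆ S) PP P = {insert z P, insert z' P} := by
        ext Q
        simp only [bipartiteBelow, PP, mem_filter, mem_univ, true_and, mem_insert, mem_singleton]
        constructor
        · rintro ⟨⟨h1, h2⟩, h3⟩
          obtain ⟨w, hw, rfl⟩ := hins Q P h2 hPc h3
          rcases hall w hw h1 with rfl | rfl <;> simp
        · rintro (rfl | rfl)
          · exact ⟨⟨hS1, hS2⟩, hPS⟩
          · exact ⟨⟨hz'prim, by rw [card_insert_of_notMem hz'P, hPc]⟩, subset_insert _ _⟩
      rw [heq, card_pair]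
      · exact even_two
      · intro h
        have : z' ∈ insert z P := by rw [h]; simp
        rcases mem_insert.1 this with h | h
        · exact hne h
        · exact hz'P h
  have hD0 : (bipartiteBelow (fun S P => P ⊆ S) PP P0).card = 1 := by
    have hTne : (univ.filter (fun v : V => ∀ l, v ≠ e l)).Nonempty := by
      obtain ⟨v, hv⟩ := hT
      exact ⟨v, by simpa using hv⟩
    obtain ⟨t, ht, htmax⟩ := exists_max_image _ (R i0) hTne
    simp only [mem_filter, mem_univ, true_and] at ht htmax
    have hmem : ∀ l, l ≠ i0 → e l ∈ P0 := fun l hl => mem_image_of_mem _ (by simp [hl])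
    have htP0 : t ∉ P0 := by
      intro h
      obtain ⟨l, _, hl⟩ := mem_image.1 h
      exact ht l hl.symm
    have hi0P0 : e i0 ∉ P0 := by
      intro h
      obtain ⟨l, hl, hl'⟩ := mem_image.1 h
      simp [heinj hl'] at hl
    have hforce : ∀ (S : Finset V) (i : I) (y : V), (∀ l, y ≠ e l) → e i ∈ S →
        ¬ (∀ s ∈ S, R i y ≤ R i s) := by
      intro S i y hy hi h
      exact hy i (hR i (le_antisymm (h _ hi) (he1 i y)))
    rw [card_eq_one]
    refine ⟨insert t P0, ?_⟩
    ext Q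
    simp only [bipartiteBelow, PP, mem_filter, mem_univ, true_and, mem_singleton]
    constructor
    · rintro ⟨⟨h1, h2⟩, h3⟩
      obtain ⟨w, hw, rfl⟩ := hins Q P0 h2 hP0c h3
      obtain ⟨i, hi⟩ := h1 t
      have hii : i = i0 := by
        by_contra hne
        exact hforce _ i t ht (mem_insert_of_mem (hmem i hne)) hi
      subst hii
      have hwT : ∀ l, w ≠ e l := by
        intro l hl
        by_cases hli : l = i
        · subst hli
          exact hforce _ l t ht (by rw [hl]; simp) hi
        · exact hw (hl ▸ hmem l hli)
      have : w = t := hR i (le_antisymm (htmax w hwT) (hi w (mem_insert_self _ _)))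
      rw [this]
    · rintro rfl
      refine ⟨⟨?_, by rw [card_insert_of_notMem htP0, hP0c]⟩, subset_insert _ _⟩
      intro y
      by_cases hy : ∃ l, y = e l
      · obtain ⟨l, rfl⟩ := hy
        exact ⟨l, fun s _ => he1 l s⟩
      · push Not at hy
        refine ⟨i0, fun s hs => ?_⟩
        rcases mem_insert.1 hs with rfl | hs
        · exact htmax y hy
        · obtain ⟨l, hl, rfl⟩ := mem_image.1 hs
          exact (he2 i0 l y (by simpa using hl) hy).le
  have h1 : Even (∑ S ∈ PP, (bipartiteAbove (fun S P => P ⊆ S) DD S).card) :=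
    Finset.even_sum _ hL
  rw [hcount, ← Finset.add_sum_erase _ _ hP0D, hD0] at h1
  have h2 : Even (∑ P ∈ DD.erase P0, (bipartiteBelow (fun S P => P ⊆ S) PP P).card) :=
    Finset.even_sum _ (fun P hP => hD1 P (mem_of_mem_erase hP) (ne_of_mem_erase hP))
  rw [Nat.even_iff] at h1 h2
  omega

lemma scarf_grid {I : Type} [Fintype I] [DecidableEq I] [Nonempty I] (k : ℕ)
    (c : (I → ℕ) → I) :
    ∃ z : I → ℕ, ∑ i, z i = k ∧ ∀ i, z i < Fintype.card I ∨
      ∃ w : I → ℕ, ∑ i, w i = k ∧ c w = i ∧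
        ∀ l, w l < z l + Fintype.card I ∧ z l < w l + Fintype.card I := by
  classical
  let T := {x : I → Fin (k + 1) // ∑ i, (x i : ℕ) = k}
  let N := Fintype.card T
  let idx : T ≃ Fin N := Fintype.equivFin T
  let idI : I ≃ Fin (Fintype.card I) := Fintype.equivFin I
  let g : T → I → ℕ := fun x i => (x.1 i : ℕ)
  have hgsum : ∀ x, ∑ i, g x i = k := fun x => x.2
  have hmk : ∀ y : I → ℕ, ∑ i, y i = k → ∃ x : T, g x = y := by
    intro y hy
    have hle : ∀ i, y i < k + 1 := by
      intro i
      have := Finset.single_le_sum (f := y) (fun j _ => Nat.zero_le _) (mem_univ i)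
      omega
    exact ⟨⟨fun i => ⟨y i, hle i⟩, by simpa using hy⟩, rfl⟩
  let R : I → T ⊕ I → ℕ := fun i => Sum.elim (fun x => g x i * N + idx x + 1)
    (fun j => if j = i then 0 else (k + 1) * N + 1 + idI j)
  have hRl : ∀ i x, R i (Sum.inl x) = g x i * N + idx x + 1 := fun i x => rfl
  have hRr : ∀ i j, R i (Sum.inr j) = if j = i then 0 else (k + 1) * N + 1 + idI j :=
    fun i x => rfl
  have hlt : ∀ i x, R i (Sum.inl x) < (k + 1) * N + 1 := by
    intro i x
    rw [hRl]
    have h1 : (idx x : ℕ) < N := (idx x).2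
    have h2 : g x i ≤ k := Nat.lt_succ_iff.1 (x.1 i).2
    nlinarith
  have hmono : ∀ i x y, R i (Sum.inl x) ≤ R i (Sum.inl y) → g x i ≤ g y i := by
    intro i x y h
    rw [hRl, hRl] at h
    by_contra hc
    have h1 : (idx y : ℕ) < N := (idx y).2
    have h2 : g y i + 1 ≤ g x i := by omega
    nlinarith
  have hR : ∀ i, Function.Injective (R i) := by
    rintro i (x | a) (y | b) h
    · have h1 := hmono i x y h.le
      have h2 := hmono i y x h.ge
      have h3 : g x i = g y i := le_antisymm h1 h2
      rw [hRl, hRl, h3] at h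
      have : idx x = idx y := Fin.ext (by omega)
      rw [idx.injective this]
    · have h1 := hlt i x
      have h2 := hRl i x
      rw [h, hRr] at h1 h2
      split_ifs at h1 h2 <;> omega
    · have h1 := hlt i y
      have h2 := hRl i y
      rw [← h, hRr] at h1 h2
      split_ifs at h1 h2 <;> omega
    · rw [hRr, hRr] at h
      split_ifs at h with h1 h2 h2
      · rw [h1, h2]
      · omega
      · omega
      · have : idI a = idI b := Fin.ext (by omega)
        rw [idI.injective this]
  have hTne : Nonempty T := by
    obtain ⟨i⟩ := ‹Nonempty I›
    obtain ⟨x, _⟩ := hmk (fun j => if j = i then k else 0) (by simp)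
    exact ⟨x⟩
  obtain ⟨S, hS, hSc⟩ := scarf_main R hR Sum.inr
    (by intro i v; rw [hRr]; simp)
    (by
      rintro i j (x | a) hji hv
      · have := hlt i x
        rw [hRr, if_neg hji]; omega
      · exact absurd rfl (hv a))
    ⟨Sum.inl (Classical.choice hTne), by simp⟩
    (Sum.elim (fun x => c (g x)) id) (fun i => rfl)
  let C : Finset I := univ.filter (fun i => (Sum.inr i : T ⊕ I) ∉ S)
  have hC : ∀ i, i ∈ C ↔ (Sum.inr i : T ⊕ I) ∉ S := by intro i; simp [C]
  have hcol : ∀ i ∈ C, ∃ x : T, Sum.inl x ∈ S ∧ c (g x) = i := by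
    intro i hi
    have : i ∈ S.image (Sum.elim (fun x => c (g x)) id) := by rw [hSc]; simp
    obtain ⟨s, hs, hsi⟩ := mem_image.1 this
    rcases s with x | a
    · exact ⟨x, hs, hsi⟩
    · simp only [Sum.elim_inr, id] at hsi
      subst hsi
      exact absurd hs ((hC _).1 hi)
  have hdom : ∀ y : T, ∃ i ∈ C, ∀ x, Sum.inl x ∈ S → g y i ≤ g x i := by
    intro y
    obtain ⟨i, hi⟩ := hS (Sum.inl y)
    refine ⟨i, ?_, fun x hx => hmono i y x (hi _ hx)⟩
    rw [hC]
    intro h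
    have := hi _ h
    rw [hRl, hRr] at this
    simp at this
  obtain ⟨i1, hi1, -⟩ := hdom (Classical.choice hTne)
  obtain ⟨z, hzS, -⟩ := hcol i1 hi1
  have hmex : ∀ i, ∃ a : ℕ, (∀ x, Sum.inl x ∈ S → a ≤ g x i) ∧
      (i ∈ C → ∃ x, Sum.inl x ∈ S ∧ g x i = a) ∧ (i ∉ C → a = 0) := by
    intro i
    by_cases hi : i ∈ C
    · obtain ⟨x, hx, hmin⟩ := exists_min_image (univ.filter (fun x : T => (Sum.inl x : T ⊕ I) ∈ S))
        (fun x => g x i) ⟨z, by simpa using hzS⟩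
      simp only [mem_filter, mem_univ, true_and] at hx hmin
      exact ⟨g x i, hmin, fun _ => ⟨x, hx, rfl⟩, fun h => absurd hi h⟩
    · exact ⟨0, fun _ _ => Nat.zero_le _, fun h => absurd h hi, fun _ => rfl⟩
  choose m hm1 hm2 hm3 using hmex
  have hbig : k < ∑ i, (if i ∈ C then m i + 1 else 0) := by
    by_contra hle
    push Not at hle
    obtain ⟨y, hy⟩ := hmk (fun i => (if i ∈ C then m i + 1 else 0) +
      (if i = i1 then k - ∑ i, (if i ∈ C then m i + 1 else 0) else 0)) (by
        rw [Finset.sum_add_distrib]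
        rw [Finset.sum_ite_eq' univ i1]
        simp only [mem_univ, if_true]
        omega)
    obtain ⟨i, hi, hall⟩ := hdom y
    obtain ⟨x, hx, hxm⟩ := hm2 i hi
    have h1 := hall x hx
    rw [hy, hxm] at h1
    simp only [hi, if_true] at h1
    omega
  have hbig2 : k < ∑ i, m i + Fintype.card I := by
    refine lt_of_lt_of_le hbig ?_
    have : ∑ i, m i + Fintype.card I = ∑ i : I, (m i + 1) := by
      rw [Finset.sum_add_distrib]; simp
    rw [this]
    apply Finset.sum_le_sum
    intro i _
    split_ifs <;> omega
  have hclose : ∀ x, Sum.inl x ∈ S → ∀ l, m l ≤ g x l ∧ g x l < m l + Fintype.card I := by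
    intro x hx l
    refine ⟨hm1 l x hx, ?_⟩
    have h1 := hgsum x
    rw [← Finset.add_sum_erase _ _ (mem_univ l)] at h1 hbig2
    have h2 : ∑ i ∈ univ.erase l, m i ≤ ∑ i ∈ univ.erase l, g x i :=
      Finset.sum_le_sum (fun i _ => hm1 i x hx)
    omega
  refine ⟨g z, hgsum z, fun i => ?_⟩
  by_cases hi : i ∈ C
  · right
    obtain ⟨x, hx, hxc⟩ := hcol i hi
    refine ⟨g x, hgsum x, hxc, fun l => ?_⟩
    have h1 := hclose x hx l
    have h2 := hclose z hzS l
    omega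
  · left
    have := (hclose z hzS i).2
    rw [hm3 i hi] at this
    omega

lemma scarf_approx {I : Type} [Fintype I] [DecidableEq I] [Nonempty I]
    (u : (I → ℝ) → I → ℝ) (ε : ℝ) (hε : 0 < ε) :
    ∃ z ∈ stdSimplex ℝ I, ∀ i, z i < ε ∨
      ∃ w : I → ℝ, dist w z < ε ∧ ∀ j, u w j ≤ u w i := by
  have hmax : ∀ w : I → ℝ, ∃ i, ∀ j, u w j ≤ u w i := by
    intro w
    obtain ⟨i, _, hi⟩ := exists_max_image univ (u w) univ_nonempty
    exact ⟨i, fun j => hi j (mem_univ j)⟩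
  choose b hb using hmax
  obtain ⟨k, hk⟩ := exists_nat_gt ((Fintype.card I : ℝ) / ε)
  have hkpos : (0 : ℝ) < k := lt_of_le_of_lt (by positivity) hk
  have hk' : (Fintype.card I : ℝ) / k < ε := by
    rw [div_lt_iff₀ hε] at hk
    rw [div_lt_iff₀ hkpos]; linarith
  obtain ⟨z, hz, hall⟩ := scarf_grid (I := I) k (fun w => b (fun i => (w i : ℝ) / k))
  refine ⟨fun i => (z i : ℝ) / k, ⟨fun i => by positivity, ?_⟩, fun i => ?_⟩
  · rw [← Finset.sum_div, ← Nat.cast_sum, hz, div_self hkpos.ne']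
  · rcases hall i with h | ⟨w, hw, hwi, hd⟩
    · left
      refine lt_trans ?_ hk'
      have : (z i : ℝ) < Fintype.card I := by exact_mod_cast h
      exact div_lt_div_of_pos_right this hkpos
    · right
      refine ⟨fun i => (w i : ℝ) / k, ?_, ?_⟩
      · rw [dist_pi_lt_iff hε]
        intro l
        refine lt_trans ?_ hk'
        rw [Real.dist_eq, ← sub_div, abs_div, abs_of_pos hkpos]
        apply div_lt_div_of_pos_right _ hkpos
        have h1 : (w l : ℝ) < z l + Fintype.card I := by exact_mod_cast (hd l).1
        have h2 : (z l : ℝ) < w l + Fintype.card I := by exact_mod_cast (hd l).2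
        rw [abs_lt]; constructor <;> linarith
      · rw [← hwi]; exact hb _

lemma scarf_equilibrium {I : Type} [Fintype I] [DecidableEq I] [Nonempty I]
    (u : (I → ℝ) → I → ℝ) (hu : Continuous u) :
    ∃ z ∈ stdSimplex ℝ I, ∀ i, 0 < z i → ∀ j, u z j ≤ u z i := by
  have hpos : ∀ n : ℕ, (0 : ℝ) < 1 / ((n : ℝ) + 1) := fun n => by positivity
  choose s hs hs2 using fun n : ℕ => scarf_approx u (1 / ((n : ℝ) + 1)) (hpos n)
  obtain ⟨z, hz, φ, hφ, hlim⟩ := (isCompact_stdSimplex ℝ I).tendsto_subseq hs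
  refine ⟨z, hz, fun i hi j => ?_⟩
  by_contra hlt
  push Not at hlt
  have hopen : IsOpen {x : I → ℝ | u x i < u x j} :=
    isOpen_lt ((continuous_apply i).comp hu) ((continuous_apply j).comp hu)
  obtain ⟨δ, hδ, hball⟩ := Metric.isOpen_iff.1 hopen z hlt
  have hη : 0 < min (δ / 2) (z i / 2) := lt_min (by linarith) (by linarith)
  have hsmall : Filter.Tendsto (fun n : ℕ => 1 / ((φ n : ℝ) + 1)) Filter.atTop (nhds 0) :=
    (tendsto_one_div_add_atTop_nhds_zero_nat (𝕜 := ℝ)).comp hφ.tendsto_atTop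
  have e1 := hsmall.eventually (gt_mem_nhds hη)
  have e2 := hlim.eventually (Metric.ball_mem_nhds z hη)
  obtain ⟨n, h1, h2⟩ := (e1.and e2).exists
  have h1a := lt_of_lt_of_le h1 (min_le_left _ _)
  have h1b := lt_of_lt_of_le h1 (min_le_right _ _)
  have h2' : dist (s (φ n)) z < min (δ / 2) (z i / 2) := h2
  have h2a := lt_of_lt_of_le h2' (min_le_left _ _)
  have h2b := lt_of_lt_of_le h2' (min_le_right _ _)
  rcases hs2 (φ n) i with h | ⟨w, hw, hwu⟩
  · have h3 := lt_of_le_of_lt (dist_le_pi_dist (s (φ n)) z i) h2b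
    rw [Real.dist_eq, abs_lt] at h3
    linarith [h3.1]
  · have h4 : dist w z < δ := by
      have := dist_triangle w (s (φ n)) z
      linarith
    have h5 : u w i < u w j := hball h4
    exact absurd (hwu j) (not_le.2 h5)

lemma le_dot_of_support {n : ℕ} (x v : Fin n → ℝ) (a : ℝ) (hx : x ∈ stdSimplex ℝ (Fin n))
    (h : ∀ i, 0 < x i → a ≤ v i) : a ≤ x ⬝ᵥ v := by
  have : a = ∑ i, x i * a := by rw [← Finset.sum_mul, hx.2, one_mul]
  rw [this]
  apply Finset.sum_le_sum
  intro i _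
  rcases (hx.1 i).eq_or_lt with h0 | h0
  · simp [← h0]
  · exact mul_le_mul_of_nonneg_left (h i h0) h0.le

lemma dot_le_of_le {n : ℕ} (x v : Fin n → ℝ) (a : ℝ) (hx : x ∈ stdSimplex ℝ (Fin n))
    (h : ∀ i, v i ≤ a) : x ⬝ᵥ v ≤ a := by
  have : a = ∑ i, x i * a := by rw [← Finset.sum_mul, hx.2, one_mul]
  rw [this]
  apply Finset.sum_le_sum
  intro i _
  exact mul_le_mul_of_nonneg_left (h i) (hx.1 i)

lemma exists_nash (n : ℕ) (hn : 0 < n) (A B : Matrix (Fin n) (Fin n) ℝ)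
    (hA : ∀ i j, A i j ∈ Set.Icc (-1 : ℝ) 1)
    (hB : ∀ i j, B i j ∈ Set.Icc (-1 : ℝ) 1) :
    ∃ x ∈ stdSimplex ℝ (Fin n), ∃ y ∈ stdSimplex ℝ (Fin n), IsNash A B x y := by
  haveI : Nonempty (Fin n) := ⟨⟨0, hn⟩⟩
  let u : (Fin n ⊕ Fin n → ℝ) → Fin n ⊕ Fin n → ℝ := fun z =>
    Sum.elim (fun i => ∑ j, (A i j + 2) * z (Sum.inr j))
      (fun j => ∑ i, (B i j + 2) * z (Sum.inl i))
  have hu : Continuous u := by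
    apply continuous_pi
    rintro (i | j)
    · show Continuous (fun z : Fin n ⊕ Fin n → ℝ => ∑ j, (A i j + 2) * z (Sum.inr j))
      fun_prop
    · show Continuous (fun z : Fin n ⊕ Fin n → ℝ => ∑ i, (B i j + 2) * z (Sum.inl i))
      fun_prop
  obtain ⟨z, ⟨hz0, hz1⟩, hz⟩ := scarf_equilibrium u hu
  rw [Fintype.sum_sum_type] at hz1
  set X := ∑ i, z (Sum.inl i) with hX
  set Y := ∑ j, z (Sum.inr j) with hY
  have hul : ∀ i, u z (Sum.inl i) = ∑ j, (A i j + 2) * z (Sum.inr j) := fun _ => rfl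
  have hur : ∀ j, u z (Sum.inr j) = ∑ i, (B i j + 2) * z (Sum.inl i) := fun _ => rfl
  have hX0 : 0 ≤ X := Finset.sum_nonneg (fun i _ => hz0 _)
  have hY0 : 0 ≤ Y := Finset.sum_nonneg (fun i _ => hz0 _)
  have hulY : ∀ i, Y ≤ u z (Sum.inl i) := by
    intro i
    rw [hul, hY]
    apply Finset.sum_le_sum
    intro j _
    nlinarith [hz0 (Sum.inr j), (hA i j).1]
  have hurX : ∀ j, X ≤ u z (Sum.inr j) := by
    intro i
    rw [hur, hX]
    apply Finset.sum_le_sum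
    intro j _
    nlinarith [hz0 (Sum.inl j), (hB j i).1]
  have hXpos : 0 < X := by
    rcases hX0.eq_or_lt with h | h
    · exfalso
      have hzz : ∀ i, z (Sum.inl i) = 0 := fun i =>
        (Finset.sum_eq_zero_iff_of_nonneg (fun i _ => hz0 _)).1 h.symm i (mem_univ i)
      have hYpos : 0 < Y := by linarith
      obtain ⟨j, _, hj⟩ := Finset.exists_lt_of_sum_lt (s := univ) (f := fun _ : Fin n => (0:ℝ))
        (g := fun j => z (Sum.inr j)) (by simpa using hYpos)
      have h1 := hz (Sum.inr j) hj (Sum.inl ⟨0, hn⟩)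
      have h2 := hulY ⟨0, hn⟩
      rw [hur] at h1
      simp only [hzz, mul_zero, Finset.sum_const_zero] at h1
      linarith
    · exact h
  have hYpos : 0 < Y := by
    rcases hY0.eq_or_lt with h | h
    · exfalso
      have hzz : ∀ i, z (Sum.inr i) = 0 := fun i =>
        (Finset.sum_eq_zero_iff_of_nonneg (fun i _ => hz0 _)).1 h.symm i (mem_univ i)
      obtain ⟨j, _, hj⟩ := Finset.exists_lt_of_sum_lt (s := univ) (f := fun _ : Fin n => (0:ℝ))
        (g := fun j => z (Sum.inl j)) (by simpa using hXpos)
      have h1 := hz (Sum.inl j) hj (Sum.inr ⟨0, hn⟩)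
      have h2 := hurX ⟨0, hn⟩
      rw [hul] at h1
      simp only [hzz, mul_zero, Finset.sum_const_zero] at h1
      linarith
    · exact h
  let x : Fin n → ℝ := fun i => z (Sum.inl i) / X
  let y : Fin n → ℝ := fun j => z (Sum.inr j) / Y
  have hx : x ∈ stdSimplex ℝ (Fin n) :=
    ⟨fun i => div_nonneg (hz0 _) hX0, by
      show ∑ i, z (Sum.inl i) / X = 1
      rw [← Finset.sum_div, ← hX, div_self hXpos.ne']⟩
  have hy : y ∈ stdSimplex ℝ (Fin n) :=
    ⟨fun i => div_nonneg (hz0 _) hY0, by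
      show ∑ i, z (Sum.inr i) / Y = 1
      rw [← Finset.sum_div, ← hY, div_self hYpos.ne']⟩
  have hAy : ∀ i, A.mulVec y i = u z (Sum.inl i) / Y - 2 := by
    intro i
    rw [hul]
    simp only [add_mul, Finset.sum_add_distrib, ← Finset.mul_sum]
    rw [← hY, add_div, mul_div_assoc, div_self hYpos.ne', Finset.sum_div]
    simp only [mulVec, dotProduct, y, mul_div_assoc]
    ring
  have hxB : ∀ j, vecMul x B j = u z (Sum.inr j) / X - 2 := by
    intro j
    rw [hur]
    simp only [add_mul, Finset.sum_add_distrib, ← Finset.mul_sum]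
    rw [← hX, add_div, mul_div_assoc, div_self hXpos.ne', Finset.sum_div]
    simp only [vecMul, dotProduct, x, mul_div_assoc]
    rw [mul_one, add_sub_cancel_right]
    apply Finset.sum_congr rfl
    intro i _
    ring
  refine ⟨x, hx, y, hy, fun i => ?_, fun j => ?_⟩
  · apply le_dot_of_support _ _ _ hx
    intro i' hi'
    rw [hAy, hAy]
    have := hz (Sum.inl i') (by
      by_contra h
      exact absurd (div_nonpos_of_nonpos_of_nonneg (not_lt.1 h) hX0) (not_le.2 hi')) (Sum.inl i)
    have := div_le_div_of_nonneg_right this hY0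
    linarith
  · rw [dotProduct_mulVec, dotProduct_comm]
    apply le_dot_of_support _ _ _ hy
    intro j' hj'
    rw [hxB, hxB]
    have := hz (Sum.inr j') (by
      by_contra h
      exact absurd (div_nonpos_of_nonpos_of_nonneg (not_lt.1 h) hY0) (not_le.2 hj')) (Sum.inr j)
    have := div_le_div_of_nonneg_right this hX0
    linarith

lemma payoff_mem {n : ℕ} (A : Matrix (Fin n) (Fin n) ℝ)
    (hA : ∀ i j, A i j ∈ Set.Icc (-1 : ℝ) 1) (x y : Fin n → ℝ)
    (hx : x ∈ stdSimplex ℝ (Fin n)) (hy : y ∈ stdSimplex ℝ (Fin n)) :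
    x ⬝ᵥ A.mulVec y ∈ Set.Icc (-1 : ℝ) 1 := by
  constructor
  · apply le_dot_of_support _ _ _ hx
    intro i _
    rw [mulVec, dotProduct_comm]
    exact le_dot_of_support _ _ _ hy (fun j _ => (hA i j).1)
  · apply dot_le_of_le _ _ _ hx
    intro i
    rw [mulVec, dotProduct_comm]
    exact dot_le_of_le _ _ _ hy (fun j => (hA i j).2)

/-- **Mangasarian–Stone equivalence theorem.** For a bimatrix game with payoff
matrices `A, B ∈ [−1,1]^{n×n}` (and `n ≥ 1`): (i) the optimal value of the
bilinear program `max xᵀCy − π₁ − π₂` over feasible points is `0`; (ii) a pair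
`(x̂, ŷ)` of mixed strategies is a Nash equilibrium iff there exist
`π̂₁, π̂₂ ∈ [−1,1]` making `(x̂, ŷ, π̂₁, π̂₂)` an optimal (feasible, objective
value `0`) solution; moreover any such optimal solution has `π̂₁ = x̂ᵀAŷ` and
`π̂₂ = x̂ᵀBŷ`. -/
theorem mangasarian_stone (n : ℕ) (hn : 0 < n)
    (A B : Matrix (Fin n) (Fin n) ℝ)
    (hA : ∀ i j, A i j ∈ Set.Icc (-1 : ℝ) 1)
    (hB : ∀ i j, B i j ∈ Set.Icc (-1 : ℝ) 1) :
    IsGreatest { v : ℝ | ∃ x y π₁ π₂, MSFeasible A B x y π₁ π₂ ∧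
        v = MSObj A B x y π₁ π₂ } 0 ∧
    (∀ x y : Fin n → ℝ, x ∈ stdSimplex ℝ (Fin n) → y ∈ stdSimplex ℝ (Fin n) →
      (IsNash A B x y ↔
        ∃ π₁ π₂, MSFeasible A B x y π₁ π₂ ∧ MSObj A B x y π₁ π₂ = 0)) ∧
    (∀ x y : Fin n → ℝ, ∀ π₁ π₂ : ℝ,
      MSFeasible A B x y π₁ π₂ → MSObj A B x y π₁ π₂ = 0 →
        π₁ = x ⬝ᵥ A.mulVec y ∧ π₂ = x ⬝ᵥ B.mulVec y) := by
  have hbd : ∀ x y : Fin n → ℝ, ∀ π₁ π₂ : ℝ, MSFeasible A B x y π₁ π₂ →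
      x ⬝ᵥ A.mulVec y ≤ π₁ ∧ x ⬝ᵥ B.mulVec y ≤ π₂ := by
    rintro x y p q ⟨hx, hy, -, -, h1, h2⟩
    refine ⟨dot_le_of_le _ _ _ hx h2, ?_⟩
    rw [dotProduct_mulVec, dotProduct_comm]
    exact dot_le_of_le _ _ _ hy h1
  have hobj : ∀ x y : Fin n → ℝ, ∀ π₁ π₂ : ℝ, MSObj A B x y π₁ π₂ =
      (x ⬝ᵥ A.mulVec y - π₁) + (x ⬝ᵥ B.mulVec y - π₂) := by
    intro x y p q
    rw [MSObj, add_mulVec, dotProduct_add]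
    ring
  have heq : ∀ x y : Fin n → ℝ, ∀ π₁ π₂ : ℝ,
      MSFeasible A B x y π₁ π₂ → MSObj A B x y π₁ π₂ = 0 →
        π₁ = x ⬝ᵥ A.mulVec y ∧ π₂ = x ⬝ᵥ B.mulVec y := by
    intro x y p q hf h0
    have h1 := hbd x y p q hf
    rw [hobj] at h0
    constructor <;> linarith [h1.1, h1.2]
  have hnash : ∀ x y : Fin n → ℝ, x ∈ stdSimplex ℝ (Fin n) → y ∈ stdSimplex ℝ (Fin n) →
      IsNash A B x y →
      MSFeasible A B x y (x ⬝ᵥ A.mulVec y) (x ⬝ᵥ B.mulVec y) ∧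
        MSObj A B x y (x ⬝ᵥ A.mulVec y) (x ⬝ᵥ B.mulVec y) = 0 := by
    intro x y hx hy h
    refine ⟨⟨hx, hy, payoff_mem A hA x y hx hy, payoff_mem B hB x y hx hy, h.2, h.1⟩, ?_⟩
    rw [hobj]; ring
  refine ⟨⟨?_, ?_⟩, ?_, heq⟩
  · obtain ⟨x, hx, y, hy, h⟩ := exists_nash n hn A B hA hB
    obtain ⟨h1, h2⟩ := hnash x y hx hy h
    exact ⟨x, y, _, _, h1, h2.symm⟩
  · rintro v ⟨x, y, p, q, hf, rfl⟩
    have h1 := hbd x y p q hf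
    rw [hobj]
    linarith [h1.1, h1.2]
  · intro x y hx hy
    constructor
    · intro h
      exact ⟨_, _, hnash x y hx hy h⟩
    · rintro ⟨p, q, hf, h0⟩
      obtain ⟨rfl, rfl⟩ := heq x y p q hf h0
      exact ⟨hf.2.2.2.2.2, hf.2.2.2.2.1⟩
end

section
/- Let G be a simple graph on n vertices with adjacency matrix A, let C = (1/2)A + I, and let k be an integer with 2 ≤ k ≤ n. Then for every y ∈ Δ^n with y_i ≤ 1/k for all i ∈ [n], there exists z ∈ Δ^n with z_i ∈ {0, 1/k} for all i ∈ [n] and z^T C z ≥ y^T C y. -/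
open Finset Matrix

theorem quad_step {n : ℕ} (C : Matrix (Fin n) (Fin n) ℝ) (hC : Cᵀ = C) (y : Fin n → ℝ)
    (i j : Fin n) (t : ℝ) (ht : 0 ≤ t) (hd : 0 ≤ C i i + C j j - C i j - C j i)
    (hb : C.mulVec y j ≤ C.mulVec y i) :
    y ⬝ᵥ C.mulVec y ≤ (y + t • (Pi.single i 1 - Pi.single j 1)) ⬝ᵥ
      C.mulVec (y + t • (Pi.single i 1 - Pi.single j 1)) := by
  set d : Fin n → ℝ := Pi.single i 1 - Pi.single j 1 with hdd
  have h1 : d ⬝ᵥ C.mulVec y = C.mulVec y i - C.mulVec y j := by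
    simp [hdd, sub_dotProduct]
  have h2 : y ⬝ᵥ C.mulVec d = d ⬝ᵥ C.mulVec y := by
    rw [dotProduct_mulVec, ← mulVec_transpose, hC, dotProduct_comm]
  have h3 : d ⬝ᵥ C.mulVec d = C i i + C j j - C i j - C j i := by
    simp [hdd, sub_dotProduct, mulVec_sub]
    ring
  have h4 : (y + t • d) ⬝ᵥ C.mulVec (y + t • d) =
      y ⬝ᵥ C.mulVec y + 2 * t * (d ⬝ᵥ C.mulVec y) + t ^ 2 * (d ⬝ᵥ C.mulVec d) := by
    simp only [mulVec_add, mulVec_smul, add_dotProduct, dotProduct_add, smul_dotProduct,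
      dotProduct_smul, h2, smul_eq_mul]
    ring
  rw [h4, h1, h3]
  have := mul_nonneg ht (sub_nonneg.2 hb)
  have := mul_nonneg (sq_nonneg t) hd
  linarith

theorem exists_two {n k : ℕ} (hk : 0 < k) (y : Fin n → ℝ) (hy : y ∈ stdSimplex ℝ (Fin n))
    (hyk : ∀ i, y i ≤ 1 / (k : ℝ)) (i : Fin n) (h0 : y i ≠ 0) (h1 : y i ≠ 1 / (k : ℝ)) :
    ∃ j, j ≠ i ∧ y j ≠ 0 ∧ y j ≠ 1 / (k : ℝ) := by
  by_contra hcon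
  push Not at hcon
  have hk' : (0 : ℝ) < k := by exact_mod_cast hk
  have hs := hy.2
  rw [← Finset.add_sum_erase _ _ (Finset.mem_univ i)] at hs
  have h2 : ∑ j ∈ univ.erase i, y j =
      ((univ.erase i).filter (fun j => y j ≠ 0)).card * (1 / (k : ℝ)) := by
    rw [← nsmul_eq_mul, ← Finset.sum_const, Finset.sum_filter]
    refine Finset.sum_congr rfl fun j hj => ?_
    have := hcon j (Finset.ne_of_mem_erase hj)
    split_ifs with h
    · exact this h
    · simpa using h
  rw [h2] at hs
  generalize ((univ.erase i).filter (fun j => y j ≠ 0)).card = m at hs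
  have p0 : 0 < y i := lt_of_le_of_ne (hy.1 i) (Ne.symm h0)
  have p1 : y i < 1 / (k : ℝ) := lt_of_le_of_ne (hyk i) h1
  have e : y i * k + m = k := by
    field_simp at hs
    linarith
  have q0 : (m : ℝ) < k := by nlinarith
  have q1 : (k : ℝ) < m + 1 := by
    rw [lt_div_iff₀ hk'] at p1
    linarith
  have q0' : m < k := by exact_mod_cast q0
  have q1' : k < m + 1 := by exact_mod_cast q1
  omega

theorem round_step {n k : ℕ} (C : Matrix (Fin n) (Fin n) ℝ) (hC : Cᵀ = C) (y : Fin n → ℝ)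
    (hy : y ∈ stdSimplex ℝ (Fin n)) (hyk : ∀ i, y i ≤ 1 / (k : ℝ))
    (i j : Fin n) (hij : i ≠ j) (hd : 0 ≤ C i i + C j j - C i j - C j i)
    (hb : C.mulVec y j ≤ C.mulVec y i)
    (hi0 : y i ≠ 0) (hi1 : y i ≠ 1 / (k : ℝ)) (hj0 : y j ≠ 0) (hj1 : y j ≠ 1 / (k : ℝ)) :
    ∃ w ∈ stdSimplex ℝ (Fin n), (∀ l, w l ≤ 1 / (k : ℝ)) ∧
      (univ.filter fun l => w l ≠ 0 ∧ w l ≠ 1 / (k : ℝ)).card <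
        (univ.filter fun l => y l ≠ 0 ∧ y l ≠ 1 / (k : ℝ)).card ∧
      y ⬝ᵥ C.mulVec y ≤ w ⬝ᵥ C.mulVec w := by
  obtain ⟨t, ht, hti, htj, hor⟩ : ∃ t : ℝ, 0 ≤ t ∧ t ≤ 1 / (k : ℝ) - y i ∧ t ≤ y j ∧
      (t = 1 / (k : ℝ) - y i ∨ t = y j) :=
    ⟨min (1 / (k : ℝ) - y i) (y j), le_min (sub_nonneg.2 (hyk i)) (hy.1 j), min_le_left _ _,
      min_le_right _ _, min_choice _ _⟩
  have hwi : (y + t • (Pi.single i 1 - Pi.single j 1) : Fin n → ℝ) i = y i + t := by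
    simp [hij]
  have hwj : (y + t • (Pi.single i 1 - Pi.single j 1) : Fin n → ℝ) j = y j - t := by
    simp [hij.symm]
    ring
  have hwl : ∀ l, l ≠ i → l ≠ j →
      (y + t • (Pi.single i 1 - Pi.single j 1) : Fin n → ℝ) l = y l := by
    intro l h1 h2
    simp [h1, h2]
  have hsum : ∑ l, (y + t • (Pi.single i 1 - Pi.single j 1) : Fin n → ℝ) l = 1 := by
    simp [Finset.sum_add_distrib, ← Finset.mul_sum, hy.2]
  have hq := quad_step C hC y i j t ht hd hb
  generalize (y + t • (Pi.single i 1 - Pi.single j 1) : Fin n → ℝ) = w at *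
  refine ⟨w, ⟨fun l => ?_, hsum⟩, fun l => ?_, ?_, hq⟩
  · by_cases h1 : l = i
    · subst h1; have := hy.1 l; linarith
    by_cases h2 : l = j
    · subst h2; linarith
    rw [hwl l h1 h2]; exact hy.1 l
  · by_cases h1 : l = i
    · subst h1; linarith
    by_cases h2 : l = j
    · subst h2; have := hyk l; linarith
    rw [hwl l h1 h2]; exact hyk l
  · apply Finset.card_lt_card
    rw [Finset.ssubset_iff_of_subset]
    · rcases hor with h | h
      · refine ⟨i, by simpa using ⟨hi0, by simpa using hi1⟩, ?_⟩
        have : w i = 1 / (k : ℝ) := by linarith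
        simp [this]
      · refine ⟨j, by simpa using ⟨hj0, by simpa using hj1⟩, ?_⟩
        have : w j = 0 := by linarith
        simp [this]
    · intro l hl
      rw [Finset.mem_filter] at hl ⊢
      refine ⟨Finset.mem_univ _, ?_⟩
      by_cases h1 : l = i
      · subst h1; exact ⟨hi0, hi1⟩
      by_cases h2 : l = j
      · subst h2; exact ⟨hj0, hj1⟩
      rw [← hwl l h1 h2]; exact hl.2

theorem round_all {n k : ℕ} (hk : 0 < k) (C : Matrix (Fin n) (Fin n) ℝ) (hC : Cᵀ = C)
    (hd : ∀ i j, i ≠ j → 0 ≤ C i i + C j j - C i j - C j i) (N : ℕ) :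
    ∀ y : Fin n → ℝ, y ∈ stdSimplex ℝ (Fin n) → (∀ i, y i ≤ 1 / (k : ℝ)) →
    (univ.filter fun l => y l ≠ 0 ∧ y l ≠ 1 / (k : ℝ)).card = N →
    ∃ z : Fin n → ℝ, z ∈ stdSimplex ℝ (Fin n) ∧ (∀ i, z i = 0 ∨ z i = 1 / (k : ℝ)) ∧
      y ⬝ᵥ C.mulVec y ≤ z ⬝ᵥ C.mulVec z := by
  induction N using Nat.strong_induction_on with
  | _ N ih =>
    intro y hy hyk hN
    by_cases h : ∀ i, y i = 0 ∨ y i = 1 / (k : ℝ)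
    · exact ⟨y, hy, h, le_rfl⟩
    simp only [not_forall, not_or] at h
    obtain ⟨i, hi0, hi1⟩ := h
    obtain ⟨j, hji, hj0, hj1⟩ := exists_two hk y hy hyk i hi0 hi1
    obtain ⟨w, hw, hwk, hc, hq⟩ : ∃ w ∈ stdSimplex ℝ (Fin n), (∀ l, w l ≤ 1 / (k : ℝ)) ∧
      (univ.filter fun l => w l ≠ 0 ∧ w l ≠ 1 / (k : ℝ)).card <
        (univ.filter fun l => y l ≠ 0 ∧ y l ≠ 1 / (k : ℝ)).card ∧
      y ⬝ᵥ C.mulVec y ≤ w ⬝ᵥ C.mulVec w := by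
      rcases le_total (C.mulVec y j) (C.mulVec y i) with hb | hb
      · exact round_step C hC y hy hyk i j hji.symm (hd _ _ hji.symm) hb hi0 hi1 hj0 hj1
      · exact round_step C hC y hy hyk j i hji (hd _ _ hji) hb hj0 hj1 hi0 hi1
    obtain ⟨z, hz, hz1, hz2⟩ := ih _ (hN ▸ hc) w hw hwk rfl
    exact ⟨z, hz, hz1, hq.trans hz2⟩

/-- **Rounding feasible solutions of the NDkS quadratic program.** Let `G` be a
simple graph on `n` vertices with adjacency matrix `A`, let `C = (1/2)A + I`,
and let `2 ≤ k ≤ n`. Then for every `y ∈ Δ^n` with `y_i ≤ 1/k` for all `i`,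
there is `z ∈ Δ^n` with every entry equal to `0` or `1/k` and
`zᵀCz ≥ yᵀCy`. -/
theorem qp_rounding (n k : ℕ) (hk : 2 ≤ k) (hkn : k ≤ n)
    (G : SimpleGraph (Fin n)) [DecidableRel G.Adj]
    (y : Fin n → ℝ) (hy : y ∈ stdSimplex ℝ (Fin n))
    (hyk : ∀ i, y i ≤ 1 / (k : ℝ)) :
    ∃ z : Fin n → ℝ, z ∈ stdSimplex ℝ (Fin n) ∧
      (∀ i, z i = 0 ∨ z i = 1 / (k : ℝ)) ∧
      y ⬝ᵥ ((1 / 2 : ℝ) • G.adjMatrix ℝ + 1).mulVec y ≤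
        z ⬝ᵥ ((1 / 2 : ℝ) • G.adjMatrix ℝ + 1).mulVec z := by
  refine round_all (by omega) _ ?_ ?_ _ y hy hyk rfl
  · simp [Matrix.transpose_add, Matrix.transpose_smul]
  · intro i j hij
    simp only [Matrix.add_apply, Matrix.smul_apply, SimpleGraph.adjMatrix_apply,
      Matrix.one_apply_eq, Matrix.one_apply_ne hij, Matrix.one_apply_ne hij.symm, smul_eq_mul,
      SimpleGraph.irrefl]
    split_ifs <;> norm_num
end

section
/- Let G be a simple graph on n vertices with adjacency matrix A, let C = (1/2)A + I, and let k be an integer with 2 ≤ k ≤ n. Then the maximum of x^T C x over the feasible region {x ∈ Δ^n : x_i ≤ 1/k for all i ∈ [n]} equals ρ* + 1/k, where ρ* is the maximum, over all vertex subsets S of size exactly k, of |E(S)|/k² (the normalized density of the subgraph induced by S). -/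
open Finset Matrix

lemma qp_ind_value (n k : ℕ) (hk : 2 ≤ k) (G : SimpleGraph (Fin n)) [DecidableRel G.Adj]
    (S : Finset (Fin n)) (hS : S.card = k) (x : Fin n → ℝ)
    (hx : ∀ i, x i = if i ∈ S then 1 / (k : ℝ) else 0) :
    x ⬝ᵥ ((1 / 2 : ℝ) • G.adjMatrix ℝ + 1).mulVec x =
      (∑ i ∈ S, ∑ j ∈ S, G.adjMatrix ℝ i j) / (2 * (k : ℝ) ^ 2) + 1 / (k : ℝ) := by
  have hk0 : (k : ℝ) ≠ 0 := by positivity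
  rw [Matrix.add_mulVec, dotProduct_add, Matrix.one_mulVec, Matrix.smul_mulVec, dotProduct_smul]
  have h1 : x ⬝ᵥ x = 1 / (k : ℝ) := by
    simp only [dotProduct, hx, mul_ite, ite_mul, mul_zero, zero_mul]
    simp only [← Finset.sum_filter, Finset.filter_filter]
    simp [hS]
    field_simp
  have h2 : x ⬝ᵥ (G.adjMatrix ℝ).mulVec x
      = (∑ i ∈ S, ∑ j ∈ S, G.adjMatrix ℝ i j) / (k : ℝ) ^ 2 := by
    have e : ∀ i, (G.adjMatrix ℝ).mulVec x i = (∑ j ∈ S, G.adjMatrix ℝ i j) * (1 / (k : ℝ)) := by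
      intro i
      simp only [Matrix.mulVec, dotProduct, hx, mul_ite, mul_zero]
      rw [← Finset.sum_filter, Finset.filter_mem_eq_inter, Finset.univ_inter, Finset.sum_mul]
    simp only [dotProduct, e]
    simp only [hx, ite_mul, zero_mul]
    rw [← Finset.sum_filter, Finset.filter_mem_eq_inter, Finset.univ_inter, Finset.sum_div]
    refine Finset.sum_congr rfl fun i _ => ?_
    field_simp
  rw [h1, h2, smul_eq_mul]
  field_simp

lemma qp_expand {n : ℕ} (C : Matrix (Fin n) (Fin n) ℝ) (x d : Fin n → ℝ) (t : ℝ) :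
    (x + t • d) ⬝ᵥ C.mulVec (x + t • d) =
      x ⬝ᵥ C.mulVec x + t * (d ⬝ᵥ C.mulVec x + x ⬝ᵥ C.mulVec d) + t ^ 2 * (d ⬝ᵥ C.mulVec d) := by
  simp only [Matrix.mulVec_add, Matrix.mulVec_smul, dotProduct_add, add_dotProduct,
    smul_dotProduct, dotProduct_smul, smul_eq_mul]
  ring

lemma qp_dd {n : ℕ} (G : SimpleGraph (Fin n)) [DecidableRel G.Adj] (i j : Fin n) (hij : i ≠ j) :
    0 ≤ (Pi.single i (1:ℝ) - Pi.single j 1 : Fin n → ℝ) ⬝ᵥ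
      ((1 / 2 : ℝ) • G.adjMatrix ℝ + 1).mulVec (Pi.single i (1:ℝ) - Pi.single j 1) := by
  simp only [Matrix.mulVec_sub, dotProduct_sub, sub_dotProduct, Matrix.mulVec_single_one,
    single_dotProduct, Matrix.col_apply, Matrix.add_apply, Matrix.smul_apply,
    SimpleGraph.adjMatrix_apply, Matrix.one_apply, smul_eq_mul, one_mul]
  simp only [hij, hij.symm, SimpleGraph.irrefl, if_false, if_true]
  split_ifs <;> norm_num

lemma qp_step {n k : ℕ} (G : SimpleGraph (Fin n)) [DecidableRel G.Adj] (x : Fin n → ℝ)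
    (hx : x ∈ stdSimplex ℝ (Fin n)) (hb : ∀ i, x i ≤ 1 / (k : ℝ)) (i j : Fin n) (hij : i ≠ j)
    (hi : 0 < x i ∧ x i < 1 / (k : ℝ)) (hj : 0 < x j ∧ x j < 1 / (k : ℝ))
    (hg : 0 ≤ (Pi.single i (1:ℝ) - Pi.single j 1 : Fin n → ℝ) ⬝ᵥ
        ((1 / 2 : ℝ) • G.adjMatrix ℝ + 1).mulVec x
      + x ⬝ᵥ ((1 / 2 : ℝ) • G.adjMatrix ℝ + 1).mulVec (Pi.single i (1:ℝ) - Pi.single j 1)) :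
    ∃ y : Fin n → ℝ, y ∈ stdSimplex ℝ (Fin n) ∧ (∀ i, y i ≤ 1 / (k : ℝ)) ∧
      x ⬝ᵥ ((1 / 2 : ℝ) • G.adjMatrix ℝ + 1).mulVec x ≤
        y ⬝ᵥ ((1 / 2 : ℝ) • G.adjMatrix ℝ + 1).mulVec y ∧
      (univ.filter fun l => 0 < y l ∧ y l < 1 / (k : ℝ)).card <
        (univ.filter fun l => 0 < x l ∧ x l < 1 / (k : ℝ)).card := by
  obtain ⟨t, ht⟩ : ∃ t, t = min (1 / (k : ℝ) - x i) (x j) := ⟨_, rfl⟩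
  have ht0 : 0 < t := by rw [ht]; exact lt_min (by linarith) hj.1
  have ht1 : t ≤ 1 / (k : ℝ) - x i := ht ▸ min_le_left _ _
  have ht2 : t ≤ x j := ht ▸ min_le_right _ _
  have ht3 : t = 1 / (k : ℝ) - x i ∨ t = x j := ht ▸ min_choice _ _
  obtain ⟨y, hy⟩ : ∃ y : Fin n → ℝ, y = x + t • (Pi.single i (1:ℝ) - Pi.single j 1) := ⟨_, rfl⟩
  have yi : y i = x i + t := by simp [hy, hij]
  have yj : y j = x j - t := by simp [hy, hij.symm]; ring
  have yl : ∀ l, l ≠ i → l ≠ j → y l = x l := by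
    intro l h1 h2; simp [hy, h1, h2]
  refine ⟨y, ⟨?_, ?_⟩, ?_, ?_, ?_⟩
  · intro l
    by_cases h1 : l = i
    · subst h1; rw [yi]; linarith
    by_cases h2 : l = j
    · subst h2; rw [yj]; linarith
    rw [yl l h1 h2]; exact hx.1 l
  · have := hx.2
    simp [hy, Finset.sum_add_distrib, ← Finset.mul_sum, this]
  · intro l
    by_cases h1 : l = i
    · subst h1; rw [yi]; linarith
    by_cases h2 : l = j
    · subst h2; rw [yj]; linarith
    rw [yl l h1 h2]; exact hb l
  · rw [hy, qp_expand]
    have := qp_dd G i j hij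
    have h1 := mul_nonneg ht0.le hg
    have h2 := mul_nonneg (sq_nonneg t) this
    linarith
  · apply Finset.card_lt_card
    rw [Finset.ssubset_iff_of_subset]
    · rcases ht3 with h | h
      · exact ⟨i, by simpa using hi, by simp [yi, h]⟩
      · exact ⟨j, by simpa using hj, by simp [yj, h]⟩
    · intro l
      simp only [mem_filter, mem_univ, true_and]
      by_cases h1 : l = i
      · subst h1; intro _; exact hi
      by_cases h2 : l = j
      · subst h2; intro _; exact hj
      rw [yl l h1 h2]; exact id

lemma qp_round {n k : ℕ} (hk : 2 ≤ k) (G : SimpleGraph (Fin n)) [DecidableRel G.Adj] (m : ℕ) :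
    ∀ x : Fin n → ℝ, x ∈ stdSimplex ℝ (Fin n) → (∀ i, x i ≤ 1 / (k : ℝ)) →
      (univ.filter fun l => 0 < x l ∧ x l < 1 / (k : ℝ)).card = m →
      ∃ S : Finset (Fin n), S.card = k ∧ x ⬝ᵥ ((1 / 2 : ℝ) • G.adjMatrix ℝ + 1).mulVec x ≤
        (∑ i ∈ S, ∑ j ∈ S, G.adjMatrix ℝ i j) / (2 * (k : ℝ) ^ 2) + 1 / (k : ℝ) := by
  induction m using Nat.strong_induction_on with
  | _ m ih =>
  intro x hx hb hm
  have hk0 : (0 : ℝ) < k := by positivity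
  by_cases h1 : 1 < m
  · rw [← hm] at h1
    obtain ⟨i, hi, j, hj, hij⟩ := Finset.one_lt_card.1 h1
    simp only [mem_filter, mem_univ, true_and] at hi hj
    have key : ∃ y : Fin n → ℝ, y ∈ stdSimplex ℝ (Fin n) ∧ (∀ i, y i ≤ 1 / (k : ℝ)) ∧
      x ⬝ᵥ ((1 / 2 : ℝ) • G.adjMatrix ℝ + 1).mulVec x ≤
        y ⬝ᵥ ((1 / 2 : ℝ) • G.adjMatrix ℝ + 1).mulVec y ∧
      (univ.filter fun l => 0 < y l ∧ y l < 1 / (k : ℝ)).card <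
        (univ.filter fun l => 0 < x l ∧ x l < 1 / (k : ℝ)).card := by
      rcases le_total 0 ((Pi.single i (1:ℝ) - Pi.single j 1 : Fin n → ℝ) ⬝ᵥ
        ((1 / 2 : ℝ) • G.adjMatrix ℝ + 1).mulVec x
        + x ⬝ᵥ ((1 / 2 : ℝ) • G.adjMatrix ℝ + 1).mulVec (Pi.single i (1:ℝ) - Pi.single j 1))
        with h | h
      · exact qp_step G x hx hb i j hij hi hj h
      · refine qp_step G x hx hb j i hij.symm hj hi ?_
        rw [← neg_sub (Pi.single i (1:ℝ) : Fin n → ℝ) (Pi.single j 1), neg_dotProduct, Matrix.mulVec_neg,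
          dotProduct_neg]
        linarith
    obtain ⟨y, y1, y2, y3, y4⟩ := key
    obtain ⟨S, hS, hle⟩ := ih _ (hm ▸ y4) y y1 y2 rfl
    exact ⟨S, hS, y3.trans hle⟩
  · obtain ⟨S, hSd⟩ : ∃ S : Finset (Fin n), S = univ.filter fun l => x l = 1 / (k : ℝ) := ⟨_, rfl⟩
    obtain ⟨F, hFd⟩ : ∃ F : Finset (Fin n),
      F = univ.filter fun l => 0 < x l ∧ x l < 1 / (k : ℝ) := ⟨_, rfl⟩
    rw [← hFd] at hm
    have hsum : ∑ l, x l = S.card * (1 / (k : ℝ)) + ∑ l ∈ F, x l := by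
      rw [← nsmul_eq_mul, ← Finset.sum_const, hSd, hFd, Finset.sum_filter, Finset.sum_filter,
        ← Finset.sum_add_distrib]
      refine Finset.sum_congr rfl fun l _ => ?_
      have a := hx.1 l
      have b := hb l
      rcases b.lt_or_eq with b | b
      · rw [if_neg b.ne]
        rcases a.lt_or_eq with a | a
        · rw [if_pos ⟨a, b⟩]; simp
        · rw [if_neg (by rintro ⟨c, _⟩; exact c.ne a)]; simp [← a]
      · rw [if_pos b, if_neg (by rintro ⟨_, c⟩; exact c.ne b), b]; simp
    rw [hx.2] at hsum
    have hF : F = ∅ := by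
      by_contra hne
      have : F.card = 1 := by
        have := Finset.card_pos.2 (Finset.nonempty_iff_ne_empty.2 hne)
        omega
      obtain ⟨a, ha⟩ := Finset.card_eq_one.1 this
      have haF : a ∈ F := by simp [ha]
      rw [hFd] at haF
      simp only [mem_filter, mem_univ, true_and] at haF
      rw [ha, Finset.sum_singleton] at hsum
      have e : (k : ℝ) = S.card + k * x a := by
        field_simp at hsum; linarith
      have u1 : 0 < k * x a := mul_pos hk0 haF.1
      have u2 : k * x a < 1 := by
        have := mul_lt_mul_of_pos_left haF.2 hk0
        rwa [mul_one_div_cancel hk0.ne'] at this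
      have v1 : (S.card : ℝ) < k := by linarith
      have v2 : (k : ℝ) < S.card + 1 := by linarith
      have w1 : S.card < k := by exact_mod_cast v1
      have w2 : k < S.card + 1 := by exact_mod_cast v2
      omega
    have hcard : S.card = k := by
      rw [hF, Finset.sum_empty] at hsum
      field_simp at hsum
      have : (k : ℝ) = S.card := by linarith
      exact_mod_cast this.symm
    refine ⟨S, hcard, (qp_ind_value n k hk G S hcard x ?_).le⟩
    intro l
    split_ifs with h
    · rw [hSd] at h; simpa using h
    · rw [hSd] at h
      simp only [mem_filter, mem_univ, true_and] at h
      by_contra hne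
      have : l ∈ F := by
        rw [hFd]
        simp only [mem_filter, mem_univ, true_and]
        exact ⟨lt_of_le_of_ne (hx.1 l) (Ne.symm hne), lt_of_le_of_ne (hb l) h⟩
      simp [hF] at this

/-- **Value of the NDkS quadratic program.** Let `G` be a simple graph on `n`
vertices with adjacency matrix `A`, let `C = (1/2)A + I`, and let `2 ≤ k ≤ n`.
If `ρ*` is the maximum over all vertex subsets `S` of size exactly `k` of the
normalized density `|E(S)|/k²` (expressed below as
`(∑_{i∈S} ∑_{j∈S} A_{ij}) / (2k²)`), then the maximum of `xᵀCx` over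
`{x ∈ Δ^n : x_i ≤ 1/k ∀i}` equals `ρ* + 1/k`. -/
theorem qp_value_eq_density (n k : ℕ) (hk : 2 ≤ k) (hkn : k ≤ n)
    (G : SimpleGraph (Fin n)) [DecidableRel G.Adj] (ρstar : ℝ)
    (hρ : IsGreatest { ρ : ℝ | ∃ S : Finset (Fin n), S.card = k ∧
        ρ = (∑ i ∈ S, ∑ j ∈ S, G.adjMatrix ℝ i j) / (2 * (k : ℝ) ^ 2) }
      ρstar) :
    IsGreatest { v : ℝ | ∃ x : Fin n → ℝ, x ∈ stdSimplex ℝ (Fin n) ∧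
        (∀ i, x i ≤ 1 / (k : ℝ)) ∧
        v = x ⬝ᵥ ((1 / 2 : ℝ) • G.adjMatrix ℝ + 1).mulVec x }
      (ρstar + 1 / (k : ℝ)) := by
  constructor
  · obtain ⟨S, hS, hr⟩ := hρ.1
    have hk0 : (k : ℝ) ≠ 0 := by positivity
    refine ⟨fun i => if i ∈ S then 1 / (k : ℝ) else 0, ⟨?_, ?_⟩, ?_, ?_⟩
    · intro i; dsimp only; split_ifs <;> positivity
    · rw [← Finset.sum_filter, Finset.filter_mem_eq_inter, Finset.univ_inter, Finset.sum_const, hS,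
        nsmul_eq_mul, mul_one_div_cancel hk0]
    · intro i; dsimp only; split_ifs
      · exact le_rfl
      · positivity
    · rw [hr]; exact (qp_ind_value n k hk G S hS _ fun _ => rfl).symm
  · rintro v ⟨x, hx, hb, rfl⟩
    obtain ⟨S, hS, hle⟩ := qp_round hk G _ x hx hb rfl
    have := hρ.2 ⟨S, hS, rfl⟩
    linarith
end

section
/- Let G be a simple graph on n vertices with adjacency matrix A and let k be an integer with 1 ≤ k ≤ n. Then the maximum of x^T A y over x, y ∈ Δ^n with x_i ≤ 1/k and y_i ≤ 1/k for all i ∈ [n] equals the maximum, over all pairs of vertex subsets S, T of size exactly k, of (∑_{i ∈ S} ∑_{j ∈ T} A_{ij}) / k². -/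
open Finset Matrix

lemma dkbs_aux (n k : ℕ) (hk : 1 ≤ k) (hkn : k ≤ n) (c x : Fin n → ℝ)
    (hx : x ∈ stdSimplex ℝ (Fin n)) (hxk : ∀ i, x i ≤ 1 / (k : ℝ)) :
    ∃ S : Finset (Fin n), S.card = k ∧ ∑ i, x i * c i ≤ (∑ i ∈ S, c i) / k := by
  have hk0 : (0 : ℝ) < k := by exact_mod_cast hk
  have hne : (powersetCard k (univ : Finset (Fin n))).Nonempty := by
    apply powersetCard_nonempty.2; simpa using hkn
  obtain ⟨S, hS, hmax⟩ := exists_max_image _ (fun S => ∑ i ∈ S, c i) hne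
  have hSk : S.card = k := (mem_powersetCard.1 hS).2
  have hSne : S.Nonempty := card_pos.1 (by omega)
  obtain ⟨m, hm, hmin⟩ := exists_min_image S c hSne
  have hout : ∀ j, j ∉ S → c j ≤ c m := by
    intro j hj
    have hj' : j ∉ S.erase m := fun h => hj (mem_of_mem_erase h)
    have h := hmax (insert j (S.erase m)) (by
      rw [mem_powersetCard]
      refine ⟨subset_univ _, ?_⟩
      rw [card_insert_of_notMem hj', card_erase_of_mem hm]; omega)
    simp only [sum_insert hj'] at h
    have := add_sum_erase S c hm
    linarith
  refine ⟨S, hSk, ?_⟩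
  have key : ∑ i, (c i - c m) * (x i - if i ∈ S then 1 / (k : ℝ) else 0) ≤ 0 := by
    apply sum_nonpos
    intro i _
    split_ifs with h
    · exact mul_nonpos_of_nonneg_of_nonpos (sub_nonneg.2 (hmin i h)) (sub_nonpos.2 (hxk i))
    · rw [sub_zero]
      exact mul_nonpos_of_nonpos_of_nonneg (sub_nonpos.2 (hout i h)) (hx.1 i)
  have e : ∑ i, (c i - c m) * (x i - if i ∈ S then 1 / (k : ℝ) else 0)
      = ∑ i, x i * c i - (∑ i ∈ S, c i) / k
        - c m * (∑ i, x i - ∑ i, if i ∈ S then 1 / (k : ℝ) else 0) := by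
    have : (∑ i ∈ S, c i) / k = ∑ i, c i * (if i ∈ S then 1 / (k : ℝ) else 0) := by
      simp [mul_ite, sum_ite_mem, sum_mul, div_eq_mul_inv]
    rw [this, ← sum_sub_distrib, ← sum_sub_distrib, mul_sum, ← sum_sub_distrib]
    exact sum_congr rfl fun i _ => by ring
  have e2 : (∑ i, if i ∈ S then 1 / (k : ℝ) else 0) = 1 := by
    rw [sum_ite_mem, univ_inter, sum_const, hSk, nsmul_eq_mul]
    field_simp
  rw [e, e2, hx.2] at key
  linarith

lemma dkbs_ind (n k : ℕ) (hk : 1 ≤ k) (S : Finset (Fin n)) (hS : S.card = k) :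
    (fun i => if i ∈ S then 1 / (k : ℝ) else 0) ∈ stdSimplex ℝ (Fin n) := by
  have hk0 : (0 : ℝ) < k := by exact_mod_cast hk
  refine ⟨fun i => by dsimp only; split_ifs <;> positivity, ?_⟩
  rw [sum_ite_mem, univ_inter, sum_const, hS, nsmul_eq_mul]
  field_simp

/-- **Value of the DkBS bilinear program.** Let `G` be a simple graph on `n`
vertices with adjacency matrix `A` and let `1 ≤ k ≤ n`. If `M` is the maximum,
over all pairs of vertex subsets `S, T` of size exactly `k`, of the bipartite
density `(∑_{i∈S} ∑_{j∈T} A_{ij})/k²`, then the maximum of `xᵀAy` over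
`x, y ∈ Δ^n` with all entries of `x` and `y` at most `1/k` equals `M`. -/
theorem dkbs_bilinear_value (n k : ℕ) (hk : 1 ≤ k) (hkn : k ≤ n)
    (G : SimpleGraph (Fin n)) [DecidableRel G.Adj] (M : ℝ)
    (hM : IsGreatest { ρ : ℝ | ∃ S T : Finset (Fin n),
        S.card = k ∧ T.card = k ∧
        ρ = (∑ i ∈ S, ∑ j ∈ T, G.adjMatrix ℝ i j) / ((k : ℝ) ^ 2) } M) :
    IsGreatest { v : ℝ | ∃ x y : Fin n → ℝ,
        x ∈ stdSimplex ℝ (Fin n) ∧ y ∈ stdSimplex ℝ (Fin n) ∧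
        (∀ i, x i ≤ 1 / (k : ℝ)) ∧ (∀ i, y i ≤ 1 / (k : ℝ)) ∧
        v = x ⬝ᵥ (G.adjMatrix ℝ).mulVec y } M := by
  have hk0 : (0 : ℝ) < k := by exact_mod_cast hk
  obtain ⟨⟨S, T, hS, hT, hMe⟩, hub⟩ := hM
  constructor
  · refine ⟨_, _, dkbs_ind n k hk S hS, dkbs_ind n k hk T hT, ?_, ?_, ?_⟩
    · intro i; split_ifs
      · exact le_rfl
      · positivity
    · intro i; split_ifs
      · exact le_rfl
      · positivity
    · rw [hMe]
      simp only [dotProduct, mulVec, ite_mul, mul_ite, zero_mul, mul_zero, sum_ite_mem, univ_inter]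
      simp only [sum_div, mul_sum]
      refine sum_congr rfl fun i _ => sum_congr rfl fun j _ => ?_
      field_simp
  · rintro v ⟨x, y, hx, hy, hxk, hyk, rfl⟩
    obtain ⟨S', hS', h1⟩ := dkbs_aux n k hk hkn ((G.adjMatrix ℝ).mulVec y) x hx hxk
    obtain ⟨T', hT', h2⟩ := dkbs_aux n k hk hkn (fun j => ∑ i ∈ S', G.adjMatrix ℝ i j) y hy hyk
    have e : ∑ i ∈ S', (G.adjMatrix ℝ).mulVec y i
        = ∑ j, y j * ∑ i ∈ S', G.adjMatrix ℝ i j := by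
      simp only [mulVec, dotProduct, mul_sum]
      rw [sum_comm]
      exact sum_congr rfl fun i _ => sum_congr rfl fun j _ => mul_comm _ _
    have h3 := hub ⟨S', T', hS', hT', rfl⟩
    rw [e] at h1
    rw [sum_comm] at h2
    refine h1.trans (le_trans ?_ h3)
    rw [pow_two, ← div_div]
    exact div_le_div_of_nonneg_right h2 hk0.le
end

section
/- Let A ∈ ℝ^{n×n} and let k be an integer with 1 ≤ k ≤ n. Then for all x_0, y_0 ∈ Δ^n with entries of x_0 and y_0 at most 1/k, there exist x, y ∈ Δ^n with x_i ∈ {0, 1/k} and y_i ∈ {0, 1/k} for all i ∈ [n] such that x^T A y ≥ x_0^T A y_0. -/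
open Finset Matrix

theorem linear_rounding_aux (n k : ℕ) (hk : 1 ≤ k) (hkn : k ≤ n) (c x₀ : Fin n → ℝ)
    (hx₀ : x₀ ∈ stdSimplex ℝ (Fin n)) (hx₀k : ∀ i, x₀ i ≤ 1 / (k : ℝ)) :
    ∃ x : Fin n → ℝ, x ∈ stdSimplex ℝ (Fin n) ∧
      (∀ i, x i = 0 ∨ x i = 1 / (k : ℝ)) ∧ x₀ ⬝ᵥ c ≤ x ⬝ᵥ c := by
  have hk0 : (0 : ℝ) < k := by exact_mod_cast hk
  have hne : ((univ : Finset (Fin n)).powersetCard k).Nonempty := by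
    apply Finset.powersetCard_nonempty.2
    simpa using hkn
  obtain ⟨S, hS, hmax⟩ := Finset.exists_max_image _ (fun S => ∑ i ∈ S, c i) hne
  have hcard : S.card = k := (Finset.mem_powersetCard.1 hS).2
  have hSne : S.Nonempty := by
    rw [← Finset.card_pos]; omega
  obtain ⟨m, hm, hmin⟩ := Finset.exists_min_image S c hSne
  have hout : ∀ j, j ∉ S → c j ≤ c m := by
    intro j hj
    have hj' : j ∉ S.erase m := fun h => hj (Finset.mem_of_mem_erase h)
    have h1 := hmax (insert j (S.erase m)) (by
      rw [Finset.mem_powersetCard]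
      refine ⟨Finset.subset_univ _, ?_⟩
      rw [Finset.card_insert_of_notMem hj', Finset.card_erase_of_mem hm]
      omega)
    have h2 := Finset.add_sum_erase S c hm
    simp only [Finset.sum_insert hj'] at h1
    linarith
  have hsum : ∑ i, (if i ∈ S then 1 / (k : ℝ) else 0) = 1 := by
    rw [← Finset.sum_filter]
    simp [hcard, hk0.ne']
  refine ⟨fun i => if i ∈ S then 1 / (k : ℝ) else 0, ⟨?_, hsum⟩, ?_, ?_⟩
  · intro i
    dsimp only
    split_ifs <;> positivity
  · intro i
    dsimp only
    split_ifs <;> simp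
  · have key : 0 ≤ ∑ i, ((if i ∈ S then 1 / (k : ℝ) else 0) - x₀ i) * (c i - c m) := by
      apply Finset.sum_nonneg
      intro i _
      split_ifs with h
      · exact mul_nonneg (sub_nonneg.2 (hx₀k i)) (sub_nonneg.2 (hmin i h))
      · exact mul_nonneg_of_nonpos_of_nonpos (by linarith [hx₀.1 i])
          (sub_nonpos.2 (hout i h))
    have e : ∑ i, ((if i ∈ S then 1 / (k : ℝ) else 0) - x₀ i) * (c i - c m)
        = (∑ i, (if i ∈ S then 1 / (k : ℝ) else 0) * c i - ∑ i, x₀ i * c i)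
          - (∑ i, (if i ∈ S then 1 / (k : ℝ) else 0) - ∑ i, x₀ i) * c m := by
      rw [← Finset.sum_sub_distrib, ← Finset.sum_sub_distrib, Finset.sum_mul,
        ← Finset.sum_sub_distrib]
      apply Finset.sum_congr rfl
      intro i _
      ring
    rw [e, hsum, hx₀.2] at key
    simp only [dotProduct]
    linarith

/-- **Rounding feasible solutions of the bilinear program.** Let
`A ∈ ℝ^{n×n}` and `1 ≤ k ≤ n`. For all `x₀, y₀ ∈ Δ^n` with entries at most
`1/k`, there exist `x, y ∈ Δ^n` with every entry in `{0, 1/k}` such that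
`xᵀAy ≥ x₀ᵀAy₀`. -/
theorem bilinear_rounding (n k : ℕ) (hk : 1 ≤ k) (hkn : k ≤ n)
    (A : Matrix (Fin n) (Fin n) ℝ)
    (x₀ y₀ : Fin n → ℝ)
    (hx₀ : x₀ ∈ stdSimplex ℝ (Fin n)) (hy₀ : y₀ ∈ stdSimplex ℝ (Fin n))
    (hx₀k : ∀ i, x₀ i ≤ 1 / (k : ℝ)) (hy₀k : ∀ i, y₀ i ≤ 1 / (k : ℝ)) :
    ∃ x y : Fin n → ℝ, x ∈ stdSimplex ℝ (Fin n) ∧ y ∈ stdSimplex ℝ (Fin n) ∧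
      (∀ i, x i = 0 ∨ x i = 1 / (k : ℝ)) ∧
      (∀ i, y i = 0 ∨ y i = 1 / (k : ℝ)) ∧
      x₀ ⬝ᵥ A.mulVec y₀ ≤ x ⬝ᵥ A.mulVec y := by
  obtain ⟨x, hx, hxk, h1⟩ := linear_rounding_aux n k hk hkn (A.mulVec y₀) x₀ hx₀ hx₀k
  obtain ⟨y, hy, hyk, h2⟩ := linear_rounding_aux n k hk hkn (x ᵥ* A) y₀ hy₀ hy₀k
  refine ⟨x, y, hx, hy, hxk, hyk, h1.trans ?_⟩
  rw [Matrix.dotProduct_mulVec, Matrix.dotProduct_mulVec, dotProduct_comm _ y₀,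
    dotProduct_comm _ y]
  exact h2
end

section
/- Approximate Birkhoff–von Neumann: let d ≥ 4, let ε > 0, and let D be a d×d doubly stochastic matrix. Then for every integer m ≥ 16 · log₂(d) / ε², there exists a multiset Π of d×d permutation matrices with |Π| = m such that the doubly stochastic matrix D' = (1/m) ∑_{P ∈ Π} P satisfies max_{i,j} |D_{ij} − D'_{ij}| ≤ ε. -/
open Finset Matrix

lemma abv_mgf {α : Type*} [Fintype α] (w Y : α → ℝ) (hw : ∀ a, 0 ≤ w a) (hw1 : ∑ a, w a = 1)
    (hY : ∀ a, |Y a| ≤ 1) (hY0 : ∑ a, w a * Y a = 0) (s : ℝ) (hs : |s| ≤ 1) (m : ℕ) :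
    ∑ p : Fin m → α, (∏ k, w (p k)) * Real.exp (s * ∑ k, Y (p k)) ≤ Real.exp (m * s ^ 2) := by
  have h1 : ∑ p : Fin m → α, (∏ k, w (p k)) * Real.exp (s * ∑ k, Y (p k))
      = (∑ a, w a * Real.exp (s * Y a)) ^ m := by
    rw [Fintype.sum_pow]
    refine Finset.sum_congr rfl fun p _ => ?_
    rw [Finset.prod_mul_distrib, ← Real.exp_sum, Finset.mul_sum]
  rw [h1, Real.exp_nat_mul]
  apply pow_le_pow_left₀ (Finset.sum_nonneg fun a _ => mul_nonneg (hw a) (Real.exp_pos _).le)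
  have h2 : ∀ a, w a * Real.exp (s * Y a) ≤ w a * (1 + s ^ 2) + s * (w a * Y a) := by
    intro a
    have h3 : |s * Y a| ≤ 1 := by
      rw [abs_mul]; exact mul_le_one₀ hs (abs_nonneg _) (hY a)
    have h4 := (abs_le.1 (Real.abs_exp_sub_one_sub_id_le h3)).2
    have h5 : (s * Y a) ^ 2 ≤ s ^ 2 := by
      have : Y a ^ 2 ≤ 1 := (sq_le_one_iff_abs_le_one _).2 (hY a)
      rw [mul_pow]; nlinarith [sq_nonneg s]
    have := mul_le_mul_of_nonneg_left (show Real.exp (s * Y a) ≤ 1 + s ^ 2 + s * Y a by linarith) (hw a)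
    linarith
  calc _ ≤ ∑ a, (w a * (1 + s ^ 2) + s * (w a * Y a)) := Finset.sum_le_sum fun a _ => h2 a
    _ = 1 + s ^ 2 := by
      rw [Finset.sum_add_distrib, ← Finset.sum_mul, ← Finset.mul_sum, hw1, hY0]; ring
    _ ≤ _ := by linarith [Real.add_one_le_exp (s ^ 2)]

/-- **Approximate Birkhoff–von Neumann theorem.** Let `d ≥ 4`, `ε > 0`, and
let `D` be a `d×d` doubly stochastic matrix. Then for every integer
`m ≥ 16 log₂(d)/ε²` there is a multiset of `m` permutation matrices (recorded
by permutations `σ 1, …, σ m` of `Fin d`) whose average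
`D' = (1/m) ∑_k P_{σ k}` satisfies `max_{i,j} |D_{ij} − D'_{ij}| ≤ ε`. -/
theorem approx_birkhoff_von_neumann (d : ℕ) (hd : 4 ≤ d) (ε : ℝ) (hε : 0 < ε)
    (D : Matrix (Fin d) (Fin d) ℝ)
    (hpos : ∀ i j, 0 ≤ D i j)
    (hrow : ∀ i, ∑ j, D i j = 1)
    (hcol : ∀ j, ∑ i, D i j = 1)
    (m : ℕ) (hm : 16 * Real.logb 2 d / ε ^ 2 ≤ (m : ℝ)) :
    ∃ σ : Fin m → Equiv.Perm (Fin d),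
      ∀ i j, |D i j - (m : ℝ)⁻¹ * ∑ k, (if σ k i = j then (1 : ℝ) else 0)|
        ≤ ε := by
  have hd' : (4 : ℝ) ≤ d := by exact_mod_cast hd
  have hlog : 0 < Real.log d := Real.log_pos (by linarith)
  have hlogb : Real.log d ≤ Real.logb 2 d := by
    rw [Real.logb, le_div_iff₀ (Real.log_pos (by norm_num))]
    nlinarith [Real.log_two_lt_d9]
  have hm1 : 16 * Real.log d ≤ m * ε ^ 2 := by
    rw [div_le_iff₀ (by positivity)] at hm; linarith
  have hm0 : (0 : ℝ) < m := by
    by_contra h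
    have : (0 : ℝ) < m * ε ^ 2 := by linarith
    exact h (pos_of_mul_pos_left this (by positivity))
  have hD1 : ∀ i j, D i j ≤ 1 := fun i j => by
    rw [← hrow i]; exact Finset.single_le_sum (fun j _ => hpos i j) (Finset.mem_univ j)
  have hYb : ∀ i j (τ : Equiv.Perm (Fin d)), |D i j - (if τ i = j then (1 : ℝ) else 0)| ≤ 1 := by
    intro i j τ
    have := hpos i j
    have := hD1 i j
    rw [abs_le]
    split_ifs <;> constructor <;> linarith
  have key : ∀ (σ : Fin m → Equiv.Perm (Fin d)) i j,
      (m : ℝ) * (D i j - (m : ℝ)⁻¹ * ∑ k, (if σ k i = j then (1 : ℝ) else 0))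
      = ∑ k, (D i j - (if σ k i = j then (1 : ℝ) else 0)) := by
    intro σ i j
    rw [Finset.sum_sub_distrib, mul_sub, mul_inv_cancel_left₀ hm0.ne']
    simp
  rcases le_or_gt 1 ε with h1 | h1
  · refine ⟨fun _ => 1, fun i j => le_trans ?_ h1⟩
    have h : (m : ℝ) * (D i j - (m : ℝ)⁻¹ * ∑ _k : Fin m, (if (1 : Equiv.Perm (Fin d)) i = j then (1 : ℝ) else 0))
        = m * (D i j - (if (1 : Equiv.Perm (Fin d)) i = j then (1 : ℝ) else 0)) := by
      refine (key (fun _ => 1) i j).trans ?_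
      rw [Finset.sum_const, Finset.card_univ, Fintype.card_fin, nsmul_eq_mul]
    have h' := mul_left_cancel₀ hm0.ne' h
    rw [h']
    exact hYb i j 1
  obtain ⟨w, hw, hw1, hwD⟩ := exists_eq_sum_perm_of_mem_doublyStochastic
    (M := D) (mem_doublyStochastic_iff_sum.2 ⟨hpos, hrow, hcol⟩)
  have hwij : ∀ i j, ∑ τ, w τ * (if τ i = j then (1 : ℝ) else 0) = D i j := by
    intro i j
    rw [← hwD, Matrix.sum_apply]
    refine Finset.sum_congr rfl fun τ _ => ?_
    simp [Equiv.Perm.permMatrix, PEquiv.toMatrix_apply, eq_comm]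
  have hY0 : ∀ i j, ∑ τ, w τ * (D i j - (if τ i = j then (1 : ℝ) else 0)) = 0 := by
    intro i j
    simp only [mul_sub]
    rw [Finset.sum_sub_distrib, hwij, ← Finset.sum_mul, hw1]; ring
  by_contra! hcon
  set S : (Fin m → Equiv.Perm (Fin d)) → Fin d → Fin d → ℝ :=
    fun σ i j => ∑ k, (D i j - (if σ k i = j then (1 : ℝ) else 0)) with hS
  have hlow : ∀ σ : Fin m → Equiv.Perm (Fin d), Real.exp (m * ε ^ 2 / 2) ≤
      ∑ i, ∑ j, (Real.exp (ε / 2 * S σ i j) + Real.exp (-(ε / 2) * S σ i j)) := by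
    intro σ
    obtain ⟨i, j, hij⟩ := hcon σ
    have hk : m * ε < |S σ i j| := by
      rw [hS]; simp only; rw [← key, abs_mul, abs_of_pos hm0]
      exact mul_lt_mul_of_pos_left hij hm0
    have h2 : Real.exp (m * ε ^ 2 / 2) ≤
        Real.exp (ε / 2 * S σ i j) + Real.exp (-(ε / 2) * S σ i j) := by
      rcases lt_abs.1 hk with h | h
      · have : Real.exp (m * ε ^ 2 / 2) ≤ Real.exp (ε / 2 * S σ i j) :=
          Real.exp_le_exp.2 (by nlinarith)
        linarith [Real.exp_pos (-(ε / 2) * S σ i j)]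
      · have : Real.exp (m * ε ^ 2 / 2) ≤ Real.exp (-(ε / 2) * S σ i j) :=
          Real.exp_le_exp.2 (by nlinarith)
        linarith [Real.exp_pos (ε / 2 * S σ i j)]
    refine h2.trans ((Finset.single_le_sum (f := fun j => Real.exp (ε / 2 * S σ i j) + Real.exp (-(ε / 2) * S σ i j)) (fun j _ => by positivity)
      (Finset.mem_univ j)).trans (Finset.single_le_sum (f := fun i => ∑ j, (Real.exp (ε / 2 * S σ i j) + Real.exp (-(ε / 2) * S σ i j))) (fun i _ => by positivity)
      (Finset.mem_univ i)))
  have hsum1 : ∑ σ : Fin m → Equiv.Perm (Fin d), ∏ k, w (σ k) = 1 := by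
    rw [← Fintype.sum_pow, hw1, one_pow]
  have hfin : Real.exp (m * ε ^ 2 / 2) ≤ 2 * d ^ 2 * Real.exp (m * ε ^ 2 / 4) := by
    calc Real.exp (m * ε ^ 2 / 2)
        = ∑ σ : Fin m → Equiv.Perm (Fin d), (∏ k, w (σ k)) * Real.exp (m * ε ^ 2 / 2) := by
          rw [← Finset.sum_mul, hsum1, one_mul]
      _ ≤ ∑ σ : Fin m → Equiv.Perm (Fin d), (∏ k, w (σ k)) *
          ∑ i, ∑ j, (Real.exp (ε / 2 * S σ i j) + Real.exp (-(ε / 2) * S σ i j)) :=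
          Finset.sum_le_sum fun σ _ => mul_le_mul_of_nonneg_left (hlow σ)
            (Finset.prod_nonneg fun k _ => hw _)
      _ = ∑ i, ∑ j, ((∑ σ : Fin m → Equiv.Perm (Fin d), (∏ k, w (σ k)) * Real.exp (ε / 2 * S σ i j))
          + ∑ σ : Fin m → Equiv.Perm (Fin d), (∏ k, w (σ k)) * Real.exp (-(ε / 2) * S σ i j)) := by
          simp only [Finset.mul_sum]
          rw [Finset.sum_comm]
          refine Finset.sum_congr rfl fun i _ => ?_
          rw [Finset.sum_comm]
          refine Finset.sum_congr rfl fun j _ => ?_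
          rw [← Finset.sum_add_distrib]
          simp only [mul_add]
      _ ≤ ∑ i : Fin d, ∑ j : Fin d, (Real.exp (m * ε ^ 2 / 4) + Real.exp (m * ε ^ 2 / 4)) := by
          refine Finset.sum_le_sum fun i _ => Finset.sum_le_sum fun j _ => add_le_add ?_ ?_
          · refine (abv_mgf w _ hw hw1 (hYb i j) (hY0 i j) (ε / 2)
              (by rw [abs_le]; constructor <;> linarith) m).trans_eq ?_
            congr 1; ring
          · refine (abv_mgf w _ hw hw1 (hYb i j) (hY0 i j) (-(ε / 2))
              (by rw [abs_le]; constructor <;> linarith) m).trans_eq ?_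
            congr 1; ring
      _ = _ := by simp; ring
  have h6 : Real.exp (m * ε ^ 2 / 4) ≤ 2 * d ^ 2 := by
    rw [show (m * ε ^ 2 / 2 : ℝ) = m * ε ^ 2 / 4 + m * ε ^ 2 / 4 by ring, Real.exp_add] at hfin
    exact le_of_mul_le_mul_right hfin (Real.exp_pos _)
  have h7 : (d : ℝ) ^ 4 ≤ Real.exp (m * ε ^ 2 / 4) := by
    rw [← Real.exp_log (show (0 : ℝ) < (d : ℝ) ^ 4 by positivity), Real.log_pow]
    apply Real.exp_le_exp.2
    push_cast; linarith
  nlinarith [mul_pos (show (0:ℝ) < d ^ 2 by positivity) (show (0:ℝ) < d ^ 2 - 2 by nlinarith)]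
end

section
/- Lower bound: let p ≥ 2, let ε > 0 with ε^{−p/(p−1)} < d, and let ē = (1/d, 1/d, …, 1/d) ∈ ℝ^d. Then every u ∈ Δ^d whose support has cardinality strictly less than 1/(4 ε^{p/(p−1)}) (i.e., u is a convex combination of fewer than 1/(4 ε^{p/(p−1)}) standard basis vectors of ℝ^d) satisfies ‖ē − u‖_p > ε. -/
open Finset

/-- **Lower bound for approximate Carathéodory.** Let `p ≥ 2`, let `ε > 0`
with `ε^{−p/(p−1)} < d`, and let `ē = (1/d, …, 1/d) ∈ ℝ^d`. Then every
`u ∈ Δ^d` supported on strictly fewer than `1/(4 ε^{p/(p−1)})` coordinates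
(i.e., `u` is a convex combination of fewer than `1/(4 ε^{p/(p−1)})` standard
basis vectors) satisfies `‖ē − u‖_p > ε`. -/
theorem approx_caratheodory_lower_bound (d : ℕ) (p ε : ℝ)
    (hp : 2 ≤ p) (hε : 0 < ε)
    (hd : ε ^ (-(p / (p - 1))) < (d : ℝ))
    (u : Fin d → ℝ) (hu : u ∈ stdSimplex ℝ (Fin d))
    (hsupp : ((Finset.univ.filter fun i => u i ≠ 0).card : ℝ) <
      1 / (4 * ε ^ (p / (p - 1)))) :
    ε < pnorm p ((fun _ => 1 / (d : ℝ)) - u) := by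
  obtain ⟨hu0, hu1⟩ := hu
  set a := ε ^ (p / (p - 1)) with ha
  have ha0 : 0 < a := Real.rpow_pos_of_pos hε _
  have hap : a ^ (p - 1) = ε ^ p := by
    rw [ha, ← Real.rpow_mul hε.le, div_mul_cancel₀]
    linarith
  rw [Real.rpow_neg hε.le, ← ha] at hd
  have hd0 : (0 : ℝ) < d := lt_trans (inv_pos.mpr ha0) hd
  set S := Finset.univ.filter fun i => u i ≠ 0 with hS
  have hk0 : (0 : ℝ) ≤ (S.card : ℝ) := Nat.cast_nonneg _
  have hka : (S.card : ℝ) * a < 1 / 4 := by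
    rw [lt_div_iff₀ (by positivity)] at hsupp
    linarith
  have had : 1 < d * a := by
    rw [inv_lt_iff_one_lt_mul₀ ha0] at hd
    linarith
  have hkd : (S.card : ℝ) * (1 / d) ≤ 1 / 4 := by
    rw [mul_one_div, div_le_iff₀ hd0]
    nlinarith
  have hsum : ∑ i ∈ S, u i = 1 := by
    rw [← hu1, hS, Finset.sum_filter_ne_zero]
  have h34 : 3 / 4 ≤ ∑ i ∈ S, |1 / (d : ℝ) - u i| := by
    calc (3 / 4 : ℝ) ≤ ∑ i ∈ S, (u i - 1 / (d : ℝ)) := by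
          rw [Finset.sum_sub_distrib, hsum, Finset.sum_const, nsmul_eq_mul]
          linarith
      _ ≤ _ := Finset.sum_le_sum fun i _ => by
          rw [abs_sub_comm]
          exact le_abs_self _
  have hJ := Real.rpow_sum_le_const_mul_sum_rpow S (fun i => 1 / (d : ℝ) - u i)
    (by linarith : 1 ≤ p)
  have hle : ∑ i ∈ S, |1 / (d : ℝ) - u i| ^ p ≤ ∑ i, |1 / (d : ℝ) - u i| ^ p :=
    Finset.sum_le_sum_of_subset_of_nonneg (Finset.subset_univ _)
      fun i _ _ => by positivity
  have hT0 : 0 ≤ ∑ i, |1 / (d : ℝ) - u i| ^ p :=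
    Finset.sum_nonneg fun i _ => by positivity
  unfold pnorm
  simp only [Pi.sub_apply]
  rw [one_div p, Real.lt_rpow_inv_iff_of_pos hε.le hT0 (by linarith), ← hap]
  by_contra hcon
  push Not at hcon
  have h1 : (3 / 4 : ℝ) ^ p ≤ (1 / 4 : ℝ) ^ (p - 1) := by
    calc (3 / 4 : ℝ) ^ p ≤ (∑ i ∈ S, |1 / (d : ℝ) - u i|) ^ p :=
          Real.rpow_le_rpow (by norm_num) h34 (by linarith)
      _ ≤ _ := hJ
      _ ≤ (S.card : ℝ) ^ (p - 1) * a ^ (p - 1) :=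
          mul_le_mul_of_nonneg_left (hle.trans hcon) (by positivity)
      _ = ((S.card : ℝ) * a) ^ (p - 1) := (Real.mul_rpow hk0 ha0.le).symm
      _ ≤ _ := Real.rpow_le_rpow (by positivity) hka.le (by linarith)
  have h2 : (3 / 4 : ℝ) ^ p = 3 ^ (p - 1) * (1 / 4) ^ (p - 1) * (3 / 4) := by
    rw [← Real.mul_rpow (by norm_num) (by norm_num)]
    conv_lhs => rw [show p = (p - 1) + 1 by ring]
    rw [Real.rpow_add (by norm_num), Real.rpow_one]
    norm_num
  have h3 : (3 : ℝ) ≤ 3 ^ (p - 1) := by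
    conv_lhs => rw [← Real.rpow_one 3]
    exact Real.rpow_le_rpow_of_exponent_le (by norm_num) (by linarith)
  have h4 : (0 : ℝ) < (1 / 4) ^ (p - 1) := by positivity
  nlinarith
end

section
/- Let p ≥ 1, let 1 ≤ k ≤ d, and let ē = (1/d, 1/d, …, 1/d) ∈ ℝ^d. Then every u ∈ Δ^d whose support has cardinality at most k satisfies ‖ē − u‖_p ≥ (k · (1/k − 1/d)^p)^{1/p}. -/
open Finset

/-- **Distance from the uniform vector to sparsely supported simplex
vectors.** Let `p ≥ 1`, `1 ≤ k ≤ d`, and `ē = (1/d, …, 1/d) ∈ ℝ^d`. Then every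
`u ∈ Δ^d` whose support has cardinality at most `k` satisfies
`‖ē − u‖_p ≥ (k (1/k − 1/d)^p)^{1/p}`. -/
theorem uniform_distance_lower_bound (d k : ℕ) (p : ℝ)
    (hp : 1 ≤ p) (hk : 1 ≤ k) (hkd : k ≤ d)
    (u : Fin d → ℝ) (hu : u ∈ stdSimplex ℝ (Fin d))
    (hsupp : (Finset.univ.filter fun i => u i ≠ 0).card ≤ k) :
    ((k : ℝ) * (1 / (k : ℝ) - 1 / (d : ℝ)) ^ p) ^ (1 / p) ≤
      pnorm p ((fun _ => 1 / (d : ℝ)) - u) := by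
  have hk0 : (0 : ℝ) < k := by exact_mod_cast hk
  have hd0 : (0 : ℝ) < d := by exact_mod_cast (lt_of_lt_of_le hk hkd)
  have hkd' : (k : ℝ) ≤ d := by exact_mod_cast hkd
  have hbase : 0 ≤ 1 / (k : ℝ) - 1 / (d : ℝ) :=
    sub_nonneg.2 (one_div_le_one_div_of_le hk0 hkd')
  obtain ⟨T, hST, hT⟩ := Finset.exists_superset_card_eq hsupp (by simpa using hkd)
  have hsum : ∑ i ∈ T, u i = 1 := by
    rw [← hu.2]
    apply Finset.sum_subset (Finset.subset_univ T)
    intro i _ hi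
    by_contra h
    exact hi (hST (by simp [h]))
  have hpm := Real.rpow_arith_mean_le_arith_mean_rpow T (fun _ => 1 / (k : ℝ))
    (fun i => |1 / (d : ℝ) - u i|) (fun i _ => by positivity)
    (by simp [hT, hk0.ne']) (fun i _ => abs_nonneg _) hp
  rw [← Finset.mul_sum, ← Finset.mul_sum] at hpm
  have hlow : 1 - k / (d : ℝ) ≤ ∑ i ∈ T, |1 / (d : ℝ) - u i| := by
    have h1 : ∑ i ∈ T, (u i - 1 / (d : ℝ)) = 1 - k / (d : ℝ) := by
      rw [Finset.sum_sub_distrib, hsum]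
      simp [hT, div_eq_mul_inv]
    rw [← h1]
    refine Finset.sum_le_sum fun i _ => ?_
    rw [abs_sub_comm]
    exact le_abs_self _
  have hmean : 1 / (k : ℝ) - 1 / (d : ℝ) ≤ 1 / (k : ℝ) * ∑ i ∈ T, |1 / (d : ℝ) - u i| := by
    calc 1 / (k : ℝ) - 1 / (d : ℝ) = 1 / (k : ℝ) * (1 - k / (d : ℝ)) := by field_simp
      _ ≤ _ := by gcongr
  have h2 := (Real.rpow_le_rpow hbase hmean (by linarith : 0 ≤ p)).trans hpm
  have h3 : (k : ℝ) * (1 / (k : ℝ) - 1 / (d : ℝ)) ^ p ≤ ∑ i ∈ T, |1 / (d : ℝ) - u i| ^ p := by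
    calc _ ≤ (k : ℝ) * (1 / (k : ℝ) * ∑ i ∈ T, |1 / (d : ℝ) - u i| ^ p) := by gcongr
      _ = _ := by field_simp
  have h4 : ∑ i ∈ T, |1 / (d : ℝ) - u i| ^ p ≤ ∑ i, |1 / (d : ℝ) - u i| ^ p :=
    Finset.sum_le_sum_of_subset_of_nonneg (Finset.subset_univ T)
      (fun i _ _ => Real.rpow_nonneg (abs_nonneg _) _)
  unfold pnorm
  exact Real.rpow_le_rpow (mul_nonneg hk0.le (Real.rpow_nonneg hbase _)) (h3.trans h4)
    (by positivity)
end
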